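/- arXiv:1909.13013 — 3 statements merged into one kernel-verified Lean document; each statement's English description precedes it below -/
import Mathlib

section
/- For every fully invariant congruence c on the free monoid M = FreeMonoid ℕ, the following are equivalent: (i) c is a modular and upper-modular element of the lattice L of fully invariant congruences on M; (ii) c is a costandard element of L; (iii) c is a neutral element of L; (iv) c is one of ⊥, θ_SL, ⊤. (This is the dual rendering of the paper's main theorem: a monoid variety V is a modular and lower-modular element of the lattice 𝕄𝕆ℕ of monoid varieties iff it is standard iff it is neutral iff V ∈ {T, SL, MON}.) -/
/-- The free monoid over a countably infinite alphabet. -/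
abbrev M : Type := FreeMonoid ℕ

/-- A congruence on the free monoid is fully invariant if it is stable under
all endomorphisms of the free monoid. -/
def FullyInvariant (c : Con M) : Prop :=
  ∀ f : M →* M, ∀ u v : M, c u v → c (f u) (f v)

/-- The least fully invariant congruence containing a given set of pairs. -/
def fiClosure (S : Set (M × M)) : Con M :=
  sInf {c : Con M | FullyInvariant c ∧ ∀ p ∈ S, c p.1 p.2}

def x : M := FreeMonoid.of 0
def y : M := FreeMonoid.of 1
/-- `θ_SL`, the least fully invariant congruence containing the pairs
`(x*x, x)` and `(x*y, y*x)`. -/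
def thetaSL : Con M := fiClosure {(x * x, x), (x * y, y * x)}

/-- `c` is a modular element of the lattice of fully invariant congruences. -/
def IsModularElem (c : Con M) : Prop :=
  ∀ b d : Con M, FullyInvariant b → FullyInvariant d → b ≤ d →
    (c ⊔ b) ⊓ d = (c ⊓ d) ⊔ b

/-- `c` is an upper-modular element of the lattice of fully invariant congruences. -/
def IsUpperModularElem (c : Con M) : Prop :=
  ∀ b d : Con M, FullyInvariant b → FullyInvariant d → b ≤ c →
    c ⊓ (b ⊔ d) = b ⊔ (c ⊓ d)

/-- `c` is a costandard element of the lattice of fully invariant congruences. -/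
def IsCostandardElem (c : Con M) : Prop :=
  ∀ b d : Con M, FullyInvariant b → FullyInvariant d →
    (c ⊓ b) ⊔ d = (c ⊔ d) ⊓ (b ⊔ d)

/-- `c` is a neutral element of the lattice of fully invariant congruences. -/
def IsNeutralElem (c : Con M) : Prop :=
  ∀ b d : Con M, FullyInvariant b → FullyInvariant d →
    (c ⊔ b) ⊓ (b ⊔ d) ⊓ (d ⊔ c) = (c ⊓ b) ⊔ (b ⊓ d) ⊔ (d ⊓ c)

open FreeMonoid (of toList)

/-! ### Fully invariant congruences and their joins -/

section General

theorem FullyInvariant.inf {b d : Con M} (hb : FullyInvariant b) (hd : FullyInvariant d) :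
    FullyInvariant (b ⊓ d) :=
  fun f u v h => ⟨hb f u v h.1, hd f u v h.2⟩

/-- The congruence whose classes are the chains of steps in `b` or `d`. -/
def chainCon (b d : Con M) : Con M where
  r := Relation.EqvGen fun u v => b u v ∨ d u v
  iseqv := Relation.EqvGen.is_equivalence _
  mul' := by
    intro u v w z h k
    have hl : Relation.EqvGen (fun u v => b u v ∨ d u v) (u * w) (v * w) := by
      induction h with
      | rel _ _ h =>
        exact .rel _ _ (h.imp (fun h => b.mul h (b.refl w)) (fun h => d.mul h (d.refl w)))
      | refl _ => exact .refl _
      | symm _ _ _ ih => exact .symm _ _ ih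
      | trans _ _ _ _ _ ih₁ ih₂ => exact .trans _ _ _ ih₁ ih₂
    have hr : Relation.EqvGen (fun u v => b u v ∨ d u v) (v * w) (v * z) := by
      clear hl
      induction k with
      | rel _ _ h =>
        exact .rel _ _ (h.imp (fun h => b.mul (b.refl v) h) (fun h => d.mul (d.refl v) h))
      | refl _ => exact .refl _
      | symm _ _ _ ih => exact .symm _ _ ih
      | trans _ _ _ _ _ ih₁ ih₂ => exact .trans _ _ _ ih₁ ih₂
    exact .trans _ _ _ hl hr

theorem eqvGen_of_sup {b d : Con M} {u v : M} (h : (b ⊔ d) u v) :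
    Relation.EqvGen (fun u v => b u v ∨ d u v) u v := by
  have hb : b ≤ chainCon b d := fun _ _ h => .rel _ _ (Or.inl h)
  have hd : d ≤ chainCon b d := fun _ _ h => .rel _ _ (Or.inr h)
  exact (sup_le hb hd : b ⊔ d ≤ chainCon b d) h

theorem sup_left_apply {b d : Con M} {u v : M} (h : b u v) : (b ⊔ d) u v :=
  (le_sup_left : b ≤ b ⊔ d) h

theorem sup_right_apply {b d : Con M} {u v : M} (h : d u v) : (b ⊔ d) u v :=
  (le_sup_right : d ≤ b ⊔ d) h

/-- A set closed under two congruences is closed under their join. -/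
theorem mem_iff_of_sup {b d : Con M} {S : Set M} (hb : ∀ u v, b u v → u ∈ S → v ∈ S)
    (hd : ∀ u v, d u v → u ∈ S → v ∈ S) {u v : M} (h : (b ⊔ d) u v) : u ∈ S ↔ v ∈ S := by
  have h' := eqvGen_of_sup h
  clear h
  induction h' with
  | rel p q h =>
    rcases h with h | h
    · exact ⟨hb _ _ h, hb _ _ (b.symm h)⟩
    · exact ⟨hd _ _ h, hd _ _ (d.symm h)⟩
  | refl _ => exact Iff.rfl
  | symm _ _ _ ih => exact ih.symm
  | trans _ _ _ _ _ ih₁ ih₂ => exact ih₁.trans ih₂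

/-- The largest fully invariant congruence for which `S` is a union of classes. -/
def synCon (S : Set M) : Con M where
  r u v := ∀ (f : M →* M) (a b : M), a * f u * b ∈ S ↔ a * f v * b ∈ S
  iseqv := ⟨fun _ _ _ _ => Iff.rfl, fun h f a b => (h f a b).symm,
    fun h k f a b => (h f a b).trans (k f a b)⟩
  mul' := by
    intro u v w z h k f a b
    have h₁ := h f a (f w * b)
    have h₂ := k f (a * f v) b
    simp only [map_mul, mul_assoc] at h₁ h₂ ⊢
    exact h₁.trans h₂

theorem fullyInvariant_synCon (S : Set M) : FullyInvariant (synCon S) :=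
  fun g _ _ h f a b => h (f.comp g) a b

theorem mem_of_synCon {S : Set M} {u v : M} (h : synCon S u v) (hu : u ∈ S) : v ∈ S := by
  have := h (MonoidHom.id M) 1 1
  simp only [MonoidHom.id_apply, one_mul, mul_one] at this
  exact this.1 hu

end General

/-! ### Occurrences of letters -/

section Occ

/-- The number of occurrences of the letter `i` in the word `w`. -/
def occ (i : ℕ) (w : M) : ℕ := (toList w).count i

@[simp] theorem occ_one (i : ℕ) : occ i 1 = 0 := rfl

@[simp] theorem occ_mul (i : ℕ) (u v : M) : occ i (u * v) = occ i u + occ i v := by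
  simp [occ]

@[simp] theorem occ_pow (i : ℕ) (u : M) (n : ℕ) : occ i (u ^ n) = n * occ i u := by
  induction n with
  | zero => simp
  | succ n ih => rw [pow_succ, occ_mul, ih]; ring

@[simp] theorem occ_of (i j : ℕ) : occ i (of j) = if j = i then 1 else 0 := by
  simp [occ, List.count_singleton]

@[simp] theorem length_pow (u : M) (n : ℕ) : (u ^ n).length = n * u.length := by
  induction n with
  | zero => simp
  | succ n ih => rw [pow_succ, FreeMonoid.length_mul, ih]; ring

theorem one_le_length {u : M} (h : u ≠ 1) : 1 ≤ u.length := by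
  rw [Nat.one_le_iff_ne_zero]
  exact fun h' => h (FreeMonoid.length_eq_zero.1 h')

/-- The endomorphism sending the letter `i` to `w` and all other letters to `1`. -/
def single (i : ℕ) (w : M) : M →* M := FreeMonoid.lift fun j => if j = i then w else 1

theorem single_apply (i : ℕ) (w u : M) : single i w u = w ^ occ i u := by
  induction u using FreeMonoid.inductionOn' with
  | one => simp
  | of_mul j u ih =>
    rw [map_mul, ih, occ_mul, occ_of, pow_add]
    by_cases h : j = i <;> simp [single, h]

theorem FullyInvariant.pow_occ {c : Con M} (hc : FullyInvariant c) {u v : M} (h : c u v)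
    (i : ℕ) (w : M) : c (w ^ occ i u) (w ^ occ i v) := by
  have := hc (single i w) u v h
  rwa [single_apply, single_apply] at this

theorem FullyInvariant.pow_pow {c : Con M} (hc : FullyInvariant c) {p q : ℕ}
    (h : c (x ^ p) (x ^ q)) (w : M) : c (w ^ p) (w ^ q) := by
  simpa [x] using hc.pow_occ h 0 w

theorem pow_add_mul {c : Con M} {w : M} {k r : ℕ} (h : c (w ^ k) (w ^ (k + r))) (n : ℕ) :
    c (w ^ k) (w ^ (k + n * r)) := by
  induction n with
  | zero => simpa using c.refl _
  | succ n ih =>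
    have := c.mul ih (c.refl (w ^ r))
    rw [← pow_add, ← pow_add] at this
    refine c.trans h ?_
    convert this using 2
    ring

end Occ

/-! ### Content of words -/

section Content

/-- The congruence of having the same set of letters. -/
def contentCon : Con M where
  r u v := ∀ i, i ∈ toList u ↔ i ∈ toList v
  iseqv := ⟨fun _ _ => Iff.rfl, fun h i => (h i).symm, fun h k i => (h i).trans (k i)⟩
  mul' := by
    intro u v w z h k i
    simp [h i, k i]

theorem mem_toList_hom (f : M →* M) (u : M) (i : ℕ) :
    i ∈ toList (f u) ↔ ∃ j ∈ toList u, i ∈ toList (f (of j)) := by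
  induction u using FreeMonoid.inductionOn' with
  | one => simp
  | of_mul j u ih => simp [ih]

theorem fullyInvariant_contentCon : FullyInvariant contentCon := by
  intro f u v h i
  rw [mem_toList_hom, mem_toList_hom]
  exact exists_congr fun j => and_congr_left fun _ => h j

theorem fullyInvariant_sInf {S : Set (Con M)} (h : ∀ c ∈ S, FullyInvariant c) :
    FullyInvariant (sInf S) :=
  fun f u v huv c hc => h c hc f u v (huv c hc)

theorem fullyInvariant_thetaSL : FullyInvariant thetaSL :=
  fullyInvariant_sInf fun _ h => h.1

theorem thetaSL_le_iff {c : Con M} (hc : FullyInvariant c) :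
    thetaSL ≤ c ↔ c (x * x) x ∧ c (x * y) (y * x) := by
  constructor
  · intro h
    refine ⟨h fun c hc => ?_, h fun c hc => ?_⟩
    · exact hc.2 (x * x, x) (by simp)
    · exact hc.2 (x * y, y * x) (by simp)
  · intro h
    refine sInf_le ⟨hc, ?_⟩
    simpa using h

theorem thetaSL_mul_self (u : M) : thetaSL (u * u) u := by
  have h := ((thetaSL_le_iff fullyInvariant_thetaSL).1 le_rfl).1
  simpa [x, single_apply, pow_two] using fullyInvariant_thetaSL (single 0 u) _ _ h

theorem thetaSL_mul_comm (u v : M) : thetaSL (u * v) (v * u) := by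
  have h := ((thetaSL_le_iff fullyInvariant_thetaSL).1 le_rfl).2
  simpa [x, y] using
    fullyInvariant_thetaSL (FreeMonoid.lift fun i => if i = 0 then u else v) _ _ h

theorem thetaSL_mul_of_subset (u v : M) (h : ∀ i ∈ toList v, i ∈ toList u) :
    thetaSL (u * v) u := by
  induction v using FreeMonoid.inductionOn' with
  | one => simpa using thetaSL.refl u
  | of_mul i v ih =>
    have hi : i ∈ toList u := h i (by simp)
    obtain ⟨s, t, hst⟩ := List.append_of_mem hi
    have hu : u = FreeMonoid.ofList s * (of i * FreeMonoid.ofList t) := hst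
    have h₁ : thetaSL (u * of i) u := by
      have h₂ : thetaSL (of i * FreeMonoid.ofList t * of i) (of i * FreeMonoid.ofList t) := by
        have h₃ := thetaSL.mul (thetaSL_mul_self (of i)) (thetaSL.refl (FreeMonoid.ofList t))
        have h₄ := thetaSL_mul_comm (of i * FreeMonoid.ofList t) (of i)
        rw [← mul_assoc] at h₄
        exact thetaSL.trans h₄ h₃
      have := thetaSL.mul (thetaSL.refl (FreeMonoid.ofList s)) h₂
      rwa [← mul_assoc, ← hu] at this
    have h₅ := thetaSL.mul h₁ (thetaSL.refl v)
    rw [mul_assoc] at h₅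
    exact thetaSL.trans h₅ (ih fun j hj => h j (by simp [hj]))

theorem thetaSL_eq_contentCon : thetaSL = contentCon := by
  apply le_antisymm
  · rw [thetaSL_le_iff fullyInvariant_contentCon]
    constructor <;> intro i <;> simp [x, y, or_comm]
  · intro u v h
    exact thetaSL.trans (thetaSL.symm (thetaSL_mul_of_subset u v fun i => (h i).2))
      (thetaSL.trans (thetaSL_mul_comm u v) (thetaSL_mul_of_subset v u fun i => (h i).1))

theorem thetaSL_iff {u v : M} : thetaSL u v ↔ ∀ i, i ∈ toList u ↔ i ∈ toList v := by
  rw [thetaSL_eq_contentCon]; rfl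

theorem mem_iff_occ {u : M} {i : ℕ} : i ∈ toList u ↔ occ i u ≠ 0 := by
  rw [occ, Nat.ne_zero_iff_zero_lt, List.count_pos_iff]

/-- A fully invariant congruence that does not preserve content is a group congruence. -/
theorem exists_pow_one_of_not_le {d : Con M} (hd : FullyInvariant d) (h : ¬ d ≤ thetaSL) :
    ∃ n, n ≠ 0 ∧ d (x ^ n) 1 := by
  have key : ∀ u v : M, d u v → ∀ i, i ∈ toList u → i ∉ toList v → ∃ n, n ≠ 0 ∧ d (x ^ n) 1 := by
    intro u v huv i hu hv
    refine ⟨occ i u, mem_iff_occ.1 hu, ?_⟩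
    have h₀ : occ i v = 0 := by_contra fun h => hv (mem_iff_occ.2 h)
    simpa [h₀] using hd.pow_occ huv i x
  by_contra hn
  refine h fun u v huv => thetaSL_iff.2 fun i => ⟨fun hu => ?_, fun hv => ?_⟩
  · exact by_contra fun hv => hn (key u v huv i hu hv)
  · exact by_contra fun hu => hn (key v u (d.symm huv) i hv hu)

end Content

/-! ### Neutrality of `thetaSL` -/

section Neutral

/-- The endomorphism raising each letter to the power `n`. -/
def powHom (n : ℕ) : M →* M := FreeMonoid.lift fun i => of i ^ n

/-- The endomorphism deleting all letters that do not occur in `u`. -/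
def keep (u : M) : M →* M := FreeMonoid.lift fun i => if i ∈ toList u then of i else 1

theorem mem_toList_pow {i n : ℕ} (hn : n ≠ 0) (u : M) : i ∈ toList (u ^ n) ↔ i ∈ toList u := by
  simp [mem_iff_occ, hn]

theorem mem_powHom {n : ℕ} (hn : n ≠ 0) (u : M) (i : ℕ) :
    i ∈ toList (powHom n u) ↔ i ∈ toList u := by
  rw [mem_toList_hom]
  simp [powHom, mem_toList_pow hn]

theorem mem_keep (u w : M) (i : ℕ) :
    i ∈ toList (keep u w) ↔ i ∈ toList u ∧ i ∈ toList w := by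
  rw [mem_toList_hom]
  constructor
  · rintro ⟨j, hj, hi⟩
    by_cases h : j ∈ toList u
    · simp only [keep, FreeMonoid.lift_eval_of, if_pos h, FreeMonoid.toList_of,
        List.mem_singleton] at hi
      exact hi ▸ ⟨h, hj⟩
    · simp [keep, if_neg h] at hi
  · rintro ⟨hu, hw⟩
    exact ⟨i, hw, by simp [keep, hu]⟩

theorem keep_eq_self {u w : M} (h : ∀ i ∈ toList w, i ∈ toList u) : keep u w = w := by
  induction w using FreeMonoid.inductionOn' with
  | one => simp
  | of_mul j w ih =>
    rw [map_mul, ih fun i hi => h i (by simp [hi])]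
    have hj : j ∈ toList u := h j (by simp)
    simp [keep, hj]

theorem powHom_rel_one {d : Con M} (hd : FullyInvariant d) {n : ℕ} (h : d (x ^ n) 1) (w : M) :
    d (powHom n w) 1 := by
  induction w using FreeMonoid.inductionOn' with
  | one => simpa using d.refl 1
  | of_mul j w ih =>
    have h₁ : d (of j ^ n) 1 := by simpa using hd.pow_pow (q := 0) (by simpa using h) (of j)
    simpa [powHom] using d.mul h₁ ih

theorem rel_mul_powHom {d : Con M} (hd : FullyInvariant d) {n : ℕ} (h : d (x ^ n) 1) (u w : M) :
    d u (u * powHom n w) := by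
  simpa using d.mul (d.refl u) (d.symm (powHom_rel_one hd h w))

theorem le_inf_sup_of_pow_one {b e : Con M} (he : FullyInvariant e)
    {n : ℕ} (hn : n ≠ 0) (h : e (x ^ n) 1) : b ≤ (thetaSL ⊓ b) ⊔ e := by
  intro u v huv
  have hu : e u (u * powHom n (u * v)) := rel_mul_powHom he h _ _
  have hv : e v (v * powHom n (u * v)) := rel_mul_powHom he h _ _
  have huv' : (thetaSL ⊓ b) (u * powHom n (u * v)) (v * powHom n (u * v)) := by
    refine ⟨thetaSL_iff.2 fun i => ?_, b.mul huv (b.refl _)⟩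
    simp only [FreeMonoid.toList_mul, List.mem_append, mem_powHom hn]
    tauto
  exact Con.trans _ (sup_right_apply hu)
    (Con.trans _ (sup_left_apply huv') (Con.symm _ (sup_right_apply hv)))

theorem sup_thetaSL_eq_top {d : Con M} (hd : FullyInvariant d) (h : ¬ d ≤ thetaSL) :
    d ⊔ thetaSL = ⊤ := by
  obtain ⟨n, hn, hd'⟩ := exists_pow_one_of_not_le hd h
  have := le_inf_sup_of_pow_one (b := ⊤) hd hn hd'
  rwa [inf_top_eq, sup_comm, top_le_iff] at this

theorem thetaSL_inf_sup {b d : Con M} (hb : FullyInvariant b) (hd : FullyInvariant d)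
    (hbc : b ≤ thetaSL) : thetaSL ⊓ (b ⊔ d) = b ⊔ (thetaSL ⊓ d) := by
  refine le_antisymm ?_ (sup_le (le_inf hbc le_sup_left) (inf_le_inf_left _ le_sup_right))
  by_cases h : d ≤ thetaSL
  · rw [inf_eq_right.2 h]
    exact inf_le_right
  obtain ⟨n, hn, hd'⟩ := exists_pow_one_of_not_le hd h
  rintro u v ⟨huv, hbd⟩
  have hcont := thetaSL_iff.1 huv
  have key : ∀ w w' : M, (b ⊔ d) w w' →
      (b ⊔ (thetaSL ⊓ d)) (keep u w * powHom n u) (keep u w' * powHom n u) := by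
    intro w w' h
    have h' := eqvGen_of_sup h
    clear h
    induction h' with
    | rel w w' h =>
      rcases h with h | h
      · exact sup_left_apply (b.mul (hb _ _ _ h) (b.refl _))
      · refine sup_right_apply ⟨thetaSL_iff.2 fun i => ?_, d.mul (hd _ _ _ h) (d.refl _)⟩
        simp only [FreeMonoid.toList_mul, List.mem_append, mem_powHom hn, mem_keep]
        tauto
    | refl _ => exact Con.refl _ _
    | symm _ _ _ ih => exact Con.symm _ ih
    | trans _ _ _ _ _ ih₁ ih₂ => exact Con.trans _ ih₁ ih₂
  have hself : ∀ w : M, thetaSL w u → (b ⊔ (thetaSL ⊓ d)) w (keep u w * powHom n u) := by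
    intro w hw
    have hw' := thetaSL_iff.1 hw
    rw [keep_eq_self fun i hi => (hw' i).1 hi]
    refine sup_right_apply ⟨thetaSL_iff.2 fun i => ?_, rel_mul_powHom hd hd' _ _⟩
    simp only [FreeMonoid.toList_mul, List.mem_append, mem_powHom hn, hw' i, or_self]
  exact Con.trans _ (hself u (thetaSL.refl u))
    (Con.trans _ (key u v hbd) (Con.symm _ (hself v (thetaSL.symm huv))))

theorem isCostandardElem_thetaSL : IsCostandardElem thetaSL := by
  intro b d hb hd
  by_cases h : d ≤ thetaSL
  · rw [sup_eq_left.2 h, sup_comm b d, thetaSL_inf_sup hd hb h, sup_comm]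
  · rw [sup_comm thetaSL d, sup_thetaSL_eq_top hd h, top_inf_eq]
    obtain ⟨n, hn, hd'⟩ := exists_pow_one_of_not_le hd h
    exact le_antisymm (sup_le_sup_right inf_le_right _)
      (sup_le (le_inf_sup_of_pow_one hd hn hd') le_sup_right)

theorem isNeutralElem_thetaSL : IsNeutralElem thetaSL := by
  intro b d hb hd
  by_cases h : b ≤ thetaSL
  · rw [sup_eq_left.2 h, inf_eq_right.2 h, sup_eq_left.2 (inf_le_left : b ⊓ d ≤ b),
      inf_comm d, ← thetaSL_inf_sup hb hd h]
    exact inf_eq_left.2 (inf_le_left.trans le_sup_right)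
  by_cases h' : d ≤ thetaSL
  · rw [sup_eq_right.2 h', inf_eq_left.2 h', inf_assoc, sup_assoc,
      sup_eq_right.2 (inf_le_right : b ⊓ d ≤ d), sup_comm (thetaSL ⊓ b) d,
      ← thetaSL_inf_sup hd hb h', inf_comm (b ⊔ d), sup_comm b d]
    exact inf_eq_right.2 (inf_le_left.trans le_sup_left)
  rw [sup_thetaSL_eq_top hd h', sup_comm thetaSL b, sup_thetaSL_eq_top hb h, top_inf_eq,
    inf_top_eq]
  obtain ⟨n, hn, hbn⟩ := exists_pow_one_of_not_le hb h
  obtain ⟨m, hm, hdm⟩ := exists_pow_one_of_not_le hd h'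
  have hbd : (b ⊓ d) (x ^ (n * m)) 1 := by
    constructor
    · rw [pow_mul]
      simpa using b.pow m hbn
    · rw [mul_comm, pow_mul]
      simpa using d.pow n hdm
  have hle : ∀ e : Con M, e ≤ (thetaSL ⊓ e) ⊔ (b ⊓ d) := fun e =>
    le_inf_sup_of_pow_one (hb.inf hd) (mul_ne_zero hn hm) hbd
  apply le_antisymm
  · refine sup_le ((hle b).trans le_sup_left) ((hle d).trans (sup_le ?_ ?_))
    · rw [inf_comm]
      exact le_sup_right
    · exact le_sup_right.trans le_sup_left
  · exact sup_le (sup_le (inf_le_right.trans le_sup_left) (inf_le_left.trans le_sup_left))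
      (inf_le_left.trans le_sup_right)

theorem IsCostandardElem.isModularElem {c : Con M} (h : IsCostandardElem c) :
    IsModularElem c := by
  intro b d hb hd hbd
  rw [h d b hd hb, sup_eq_left.2 hbd]

theorem IsCostandardElem.isUpperModularElem {c : Con M} (h : IsCostandardElem c) :
    IsUpperModularElem c := by
  intro b d hb hd hbc
  rw [sup_comm b (c ⊓ d), h d b hd hb, sup_eq_left.2 hbc, sup_comm]

theorem IsNeutralElem.isModularElem {c : Con M} (h : IsNeutralElem c) : IsModularElem c := by
  intro b d hb hd hbd
  have := h b d hb hd
  rw [sup_eq_right.2 hbd, inf_eq_left.2 hbd, sup_eq_right.2 (inf_le_right : c ⊓ b ≤ b),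
    inf_assoc, inf_eq_left.2 (le_sup_left : d ≤ d ⊔ c)] at this
  rw [this, sup_comm, inf_comm]

theorem IsNeutralElem.isUpperModularElem {c : Con M} (h : IsNeutralElem c) :
    IsUpperModularElem c := by
  intro b d hb hd hbc
  have := h b d hb hd
  rw [sup_eq_left.2 hbc, inf_eq_right.2 hbc, sup_eq_left.2 (inf_le_left : b ⊓ d ≤ b)] at this
  rw [inf_comm c d, ← this]
  exact (inf_eq_left.2 (inf_le_left.trans le_sup_right)).symm

end Neutral

/-! ### Consequences of modularity -/

section Modular

theorem IsModularElem.rel_of_synCon {c : Con M} (hmod : IsModularElem c) {s t : M}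
    (hst : synCon {s, t} s t) (h : (c ⊔ (synCon {s} ⊓ synCon {s, t})) s t) : c s t := by
  have hd := fullyInvariant_synCon {s, t}
  have hb := (fullyInvariant_synCon {s}).inf hd
  by_contra hc
  have hmem : ((c ⊔ (synCon {s} ⊓ synCon {s, t})) ⊓ synCon {s, t}) s t := ⟨h, hst⟩
  rw [hmod _ _ hb hd inf_le_right] at hmem
  have hiff := mem_iff_of_sup (S := {s}) (fun u v huv hu => ?_) (fun u v huv hu => ?_) hmem
  · have : t = s := hiff.1 rfl
    exact hc (this ▸ c.refl s)
  · obtain rfl : u = s := hu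
    rcases mem_of_synCon huv.2 (by simp : u ∈ ({u, t} : Set M)) with h | h
    · exact h
    · exact absurd (h ▸ huv.1) hc
  · exact mem_of_synCon huv.1 hu

theorem length_le_of_mul_mul {a u b : M} {n : ℕ} (h : (a * u * b).length ≤ n) :
    u.length ≤ n := by
  simp only [FreeMonoid.length_mul] at h
  omega

/-- If one side of a pair involves a high power, then short words are isolated. -/
theorem synCon_of_lt_length {S : Set M} {N : ℕ} (hS : ∀ w ∈ S, w.length ≤ N) {u v : M}
    (h : ∀ f : M →* M, f u = f v ∨ (N < (f u).length ∧ N < (f v).length)) : synCon S u v := by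
  intro f a b
  rcases h f with h | ⟨hu, hv⟩
  · rw [h]
  · refine iff_of_false (fun h => ?_) (fun h => ?_)
    · exact absurd (length_le_of_mul_mul (hS _ h)) (by omega)
    · exact absurd (length_le_of_mul_mul (hS _ h)) (by omega)

theorem pow_eq_one_or_lt_length {N m : ℕ} (h : N < m) (w : M) : w = 1 ∨ N < (w ^ m).length := by
  by_cases hw : w = 1
  · exact .inl hw
  · right
    rw [length_pow]
    nlinarith [one_le_length hw]

theorem synCon_pow_mul {k : ℕ} (hk : k ≠ 0) :
    synCon {x ^ k * y, y * x ^ k} (x ^ k * y) (y * x ^ k) := by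
  intro f a b
  by_cases hx : f x = 1
  · simp [hx]
  by_cases hy : f y = 1
  · simp [hy]
  have hx' := one_le_length hx
  have hy' := one_le_length hy
  have hocc : ∀ w ∈ ({x ^ k * y, y * x ^ k} : Set M),
      occ 0 w = k ∧ occ 1 w = 1 ∧ w.length = k + 1 := by
    rintro w (rfl | rfl) <;> simp [x, y, add_comm]
  have key : ∀ w, w = a * f (x ^ k * y) * b ∨ w = a * f (y * x ^ k) * b →
      w ∈ ({x ^ k * y, y * x ^ k} : Set M) →
      a * f (x ^ k * y) * b ∈ ({x ^ k * y, y * x ^ k} : Set M) ∧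
        a * f (y * x ^ k) * b ∈ ({x ^ k * y, y * x ^ k} : Set M) := by
    intro w hw hmem
    obtain ⟨h₀, h₁, h₂⟩ := hocc w hmem
    have hlen : a.length + (k * (f x).length + (f y).length) + b.length = k + 1 := by
      rw [← h₂]
      rcases hw with rfl | rfl <;> simp [add_comm]
    have hkx : k ≤ k * (f x).length := Nat.le_mul_of_pos_right k hx'
    have ha : a = 1 := FreeMonoid.length_eq_zero.1 (by omega)
    have hb : b = 1 := FreeMonoid.length_eq_zero.1 (by omega)
    have hfx : k * (f x).length = k * 1 := by omega
    obtain ⟨i, hi⟩ := FreeMonoid.length_eq_one.1 (Nat.eq_of_mul_eq_mul_left (by omega) hfx)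
    obtain ⟨j, hj⟩ := FreeMonoid.length_eq_one.1 (show (f y).length = 1 by omega)
    have hw₀ : k * (if i = 0 then 1 else 0) + (if j = 0 then 1 else 0) = occ 0 w := by
      rcases hw with rfl | rfl <;> simp [ha, hb, hi, hj, add_comm]
    have hw₁ : k * (if i = 1 then 1 else 0) + (if j = 1 then 1 else 0) = occ 1 w := by
      rcases hw with rfl | rfl <;> simp [ha, hb, hi, hj, add_comm]
    rw [h₀] at hw₀
    rw [h₁] at hw₁
    have hij : (i = 0 ∧ j = 1) ∨ (k = 1 ∧ i = 1 ∧ j = 0) := by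
      split_ifs at hw₀ hw₁ <;> omega
    rcases hij with ⟨rfl, rfl⟩ | ⟨rfl, rfl, rfl⟩ <;>
      simp only [map_mul, map_pow, hi, hj, ha, hb, one_mul, mul_one] <;> simp [x, y]
  exact ⟨fun h => (key _ (.inl rfl) h).2, fun h => (key _ (.inr rfl) h).1⟩

/-- Modularity makes powers central as soon as two powers are identified. -/
theorem IsModularElem.rel_pow_mul {c : Con M} (hmod : IsModularElem c)
    {k r : ℕ} (hk : k ≠ 0) (hr : r ≠ 0) (h : c (x ^ k) (x ^ (k + r))) :
    c (x ^ k * y) (y * x ^ k) := by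
  refine hmod.rel_of_synCon (synCon_pow_mul hk) ?_
  set m := k + (k + 2) * r with hm
  have hlt : k + 1 < m := by
    have : k + 2 ≤ (k + 2) * r := Nat.le_mul_of_pos_right _ (by omega)
    omega
  have hcm : c (x ^ k) (x ^ m) := pow_add_mul h (k + 2)
  have hlen : ∀ w ∈ ({x ^ k * y, y * x ^ k} : Set M), w.length ≤ k + 1 := by
    rintro w (rfl | rfl) <;> simp [x, y, add_comm]
  have himg : ∀ f : M →* M, f (x ^ m * y) = f (y * x ^ m) ∨
      (k + 1 < (f (x ^ m * y)).length ∧ k + 1 < (f (y * x ^ m)).length) := by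
    intro f
    rcases pow_eq_one_or_lt_length hlt (f x) with h | h
    · left
      simp [h]
    · right
      simp only [map_mul, map_pow, FreeMonoid.length_mul]
      omega
  refine Con.trans _ (sup_left_apply (c.mul hcm (c.refl y))) (Con.trans _ (sup_right_apply
    ⟨synCon_of_lt_length (N := k + 1) (fun w hw => hlen w ?_) himg,
      synCon_of_lt_length hlen himg⟩) (sup_left_apply (c.mul (c.refl y) (c.symm hcm))))
  exact .inl hw

theorem infix_of_mul_mul {a u b w : M} (h : a * u * b = w) : toList u <:+: toList w :=
  ⟨toList a, toList b, congrArg toList h⟩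

theorem eq_one_of_mul_mul {a u b : M} (h : a * u * b = u) : a = 1 ∧ b = 1 := by
  have := congrArg FreeMonoid.length h
  simp only [FreeMonoid.length_mul] at this
  exact ⟨FreeMonoid.length_eq_zero.1 (by omega), FreeMonoid.length_eq_zero.1 (by omega)⟩

theorem eq_one_of_infix_cube {u : M}
    (h : toList (u * u * u) <:+: [0, 1, 0, 1, 0] ∨ toList (u * u * u) <:+: [0, 0, 1, 1, 0, 0]) :
    u = 1 := by
  by_contra hu
  have hlen : (u * u * u).length ≤ 6 := by
    rcases h with h | h <;> exact h.length_le.trans (by simp)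
  have hmem : ∀ i ∈ toList u, i = 0 ∨ i = 1 := by
    intro i hi
    have hi' : i ∈ toList (u * u * u) := by simp [hi]
    rcases h with h | h <;>
    · have := h.subset hi'
      simp at this
      omega
  have hu' := one_le_length hu
  simp only [FreeMonoid.length_mul] at hlen
  obtain hl | hl : u.length = 1 ∨ u.length = 2 := by omega
  · obtain ⟨i, rfl⟩ := FreeMonoid.length_eq_one.1 hl
    rcases hmem i (by simp) with rfl | rfl <;> revert h <;> decide
  · obtain ⟨i, j, rfl⟩ := FreeMonoid.length_eq_two.1 hl
    rcases hmem i (by simp) with rfl | rfl <;> rcases hmem j (by simp) with rfl | rfl <;>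
      revert h <;> decide

theorem synCon_xyxyx :
    synCon {x * y * x * y * x, x * x * y * y * x * x}
      (x * y * x * y * x) (x * x * y * y * x * x) := by
  intro f a b
  set s : M := x * y * x * y * x with hs
  set t : M := x * x * y * y * x * x with ht
  have hsl : toList s = [0, 1, 0, 1, 0] := rfl
  have htl : toList t = [0, 0, 1, 1, 0, 0] := rfl
  have hinf : ∀ u : M, a * u * b ∈ ({s, t} : Set M) →
      toList u <:+: [0, 1, 0, 1, 0] ∨ toList u <:+: [0, 0, 1, 1, 0, 0] := by
    rintro u (h | h)
    · exact .inl (hsl ▸ infix_of_mul_mul h)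
    · exact .inr (htl ▸ infix_of_mul_mul h)
  have hlen : ∀ u : M, a * u * b ∈ ({s, t} : Set M) → u.length ≤ 6 := by
    intro u hu
    rcases hinf u hu with h | h
    · exact h.length_le.trans (by simp)
    · exact h.length_le.trans (by simp)
  have hletter : ∀ u : M, a * u * b ∈ ({s, t} : Set M) → ∀ i ∈ toList u, i = 0 ∨ i = 1 := by
    intro u hu i hi
    rcases hinf u hu with h | h <;>
    · have := h.subset hi
      simp at this
      omega
  by_cases hx : f x = 1
  · simp [hs, ht, hx]
  have hx' := one_le_length hx
  by_cases hy : f y = 1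
  · have hcube : ∀ w : M, a * (f x * f x * f x * w) * b ∉ ({s, t} : Set M) := by
      intro w hw
      rw [show a * (f x * f x * f x * w) * b = a * (f x * f x * f x) * (w * b) by
        simp only [mul_assoc]] at hw
      refine hx (eq_one_of_infix_cube ?_)
      rcases hw with hw | hw
      · exact .inl (hsl ▸ infix_of_mul_mul hw)
      · exact .inr (htl ▸ infix_of_mul_mul hw)
    rw [show f s = f x * f x * f x * 1 by simp [hs, hy],
      show f t = f x * f x * f x * f x by simp [ht, hy]]
    exact iff_of_false (hcube _) (hcube _)
  have hy' := one_le_length hy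
  have hfs : f s = f x * f y * f x * f y * f x := by simp [hs]
  have hft : f t = f x * f x * f y * f y * f x * f x := by simp [ht]
  have hlong : (f x).length = 1 ∧ (f y).length = 1 ∨
      (6 < (f s).length ∧ 6 < (f t).length) := by
    simp only [hfs, hft, FreeMonoid.length_mul]
    omega
  rcases hlong with ⟨hx₁, hy₁⟩ | ⟨h₁, h₂⟩
  · obtain ⟨i, hi⟩ := FreeMonoid.length_eq_one.1 hx₁
    obtain ⟨j, hj⟩ := FreeMonoid.length_eq_one.1 hy₁
    have hfsl : toList (f s) = [i, j, i, j, i] := by rw [hfs, hi, hj]; rfl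
    have hftl : toList (f t) = [i, i, j, j, i, i] := by rw [hft, hi, hj]; rfl
    by_cases hij : i = 0 ∧ j = 1
    · obtain ⟨rfl, rfl⟩ := hij
      have hss : f s = s := toList.injective (by rw [hfsl, hsl])
      have htt : f t = t := toList.injective (by rw [hftl, htl])
      rw [hss, htt]
      constructor
      · rintro (h | h)
        · obtain ⟨rfl, rfl⟩ := eq_one_of_mul_mul h
          simp
        · have := infix_of_mul_mul h
          rw [hsl, htl] at this
          exact absurd this (by decide)
      · rintro (h | h)
        · have := infix_of_mul_mul h
          rw [hsl, htl] at this
          exact absurd this (by decide)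
        · obtain ⟨rfl, rfl⟩ := eq_one_of_mul_mul h
          simp
    · refine iff_of_false (fun h => ?_) (fun h => ?_)
      · have h₁ := hinf _ h
        have h₂ := hletter _ h i (by simp [hfsl])
        have h₃ := hletter _ h j (by simp [hfsl])
        rw [hfsl] at h₁
        rcases h₂ with rfl | rfl <;> rcases h₃ with rfl | rfl <;> revert h₁ <;>
          first | decide | exact absurd ⟨rfl, rfl⟩ hij
      · have h₁ := hinf _ h
        have h₂ := hletter _ h i (by simp [hftl])
        have h₃ := hletter _ h j (by simp [hftl])
        rw [hftl] at h₁
        rcases h₂ with rfl | rfl <;> rcases h₃ with rfl | rfl <;> revert h₁ <;>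
          first | decide | exact absurd ⟨rfl, rfl⟩ hij
  · exact iff_of_false (fun h => absurd (hlen _ h) (by omega))
      (fun h => absurd (hlen _ h) (by omega))

theorem IsModularElem.rel_mul_self {c : Con M} (hc : FullyInvariant c) (hmod : IsModularElem c)
    {r : ℕ} (hr : r ≠ 0) (h : c (x ^ 1) (x ^ (1 + r))) (hcomm : c (x * y) (y * x)) :
    c (x * x) x := by
  have hs : c (x * y * x * y * x) (x ^ 3 * (y * y)) := by
    rw [← Con.eq] at hcomm ⊢
    have h' : Commute (x : c.Quotient) (y : c.Quotient) := hcomm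
    simp only [Con.coe_mul, pow_succ, pow_zero, one_mul, mul_assoc, h'.symm.eq, h'.symm.left_comm]
  have ht : c (x * x * y * y * x * x) (x ^ 4 * (y * y)) := by
    rw [← Con.eq] at hcomm ⊢
    have h' : Commute (x : c.Quotient) (y : c.Quotient) := hcomm
    simp only [Con.coe_mul, pow_succ, pow_zero, one_mul, mul_assoc, h'.symm.eq, h'.symm.left_comm]
  have hpow : c (x ^ 3) (x ^ 4) := by
    have := hmod.rel_of_synCon synCon_xyxyx ?_
    · simpa [x, y, pow_succ] using hc.pow_occ this 0 x
    set m := 1 + 6 * r with hm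
    have hcm : c (x ^ 1) (x ^ m) := pow_add_mul h 6
    have hlen : ∀ w ∈ ({x * y * x * y * x, x * x * y * y * x * x} : Set M), w.length ≤ 6 := by
      rintro w (rfl | rfl) <;> simp [x, y]
    have himg : ∀ f : M →* M, f (x ^ m) = f (x ^ (m + 1)) ∨
        (6 < (f (x ^ m)).length ∧ 6 < (f (x ^ (m + 1))).length) := by
      intro f
      simp only [map_pow]
      by_cases hx : f x = 1
      · simp [hx]
      · right
        exact ⟨(pow_eq_one_or_lt_length (by omega) (f x)).resolve_left hx,
          (pow_eq_one_or_lt_length (by omega) (f x)).resolve_left hx⟩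
    refine Con.trans _ (sup_left_apply hs) (Con.trans _ (Con.mul _ ?_ (Con.refl _ _))
      (sup_left_apply (c.symm ht)))
    have h₁ := c.mul (c.refl (x ^ 2)) hcm
    have h₂ := c.mul (c.refl (x ^ 3)) hcm
    rw [← pow_add, ← pow_add] at h₁ h₂
    refine Con.trans _ (sup_left_apply h₁) (Con.trans _ ?_ (sup_left_apply (c.symm h₂)))
    have h₃ : (synCon {x * y * x * y * x} ⊓ synCon {x * y * x * y * x, x * x * y * y * x * x})
        (x ^ m) (x ^ (m + 1)) :=
      ⟨synCon_of_lt_length (N := 6) (fun w hw => hlen w (.inl hw)) himg,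
        synCon_of_lt_length hlen himg⟩
    have h₄ := Con.mul _ (Con.refl _ (x ^ 2)) h₃
    rw [← pow_add, ← pow_add, show 2 + (m + 1) = 3 + m by omega] at h₄
    exact sup_right_apply h₄
  have h₁ : c (x ^ 1) (x ^ (1 + 3 * r)) := pow_add_mul h 3
  have h₂ := c.mul hpow (c.refl (x ^ (1 + 3 * r - 3)))
  have h₃ := c.mul h₁ (c.refl x)
  rw [← pow_add, ← pow_add, show 3 + (1 + 3 * r - 3) = 1 + 3 * r by omega,
    show 4 + (1 + 3 * r - 3) = 1 + 3 * r + 1 by omega, pow_succ] at h₂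
  have h₄ := c.trans h₁ (c.trans h₂ (c.symm h₃))
  rw [pow_one] at h₄
  exact c.symm h₄

end Modular

/-! ### Consequences of upper-modularity -/

section UpperModular

theorem IsUpperModularElem.mem_of_rel {c b d : Con M} (hupper : IsUpperModularElem c)
    (hb : FullyInvariant b) (hd : FullyInvariant d) (hbc : b ≤ c) {S : Set M}
    (hbS : ∀ u v, b u v → u ∈ S → v ∈ S) (hdS : ∀ u v, c u v → d u v → u ∈ S → v ∈ S)
    {u v : M} (hc : c u v) (h : (b ⊔ d) u v) (hu : u ∈ S) : v ∈ S := by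
  have hmem : (c ⊓ (b ⊔ d)) u v := ⟨hc, h⟩
  rw [hupper b d hb hd hbc] at hmem
  exact (mem_iff_of_sup hbS (fun u v huv => hdS u v (And.left huv) (And.right huv)) hmem).1 hu

/-- The words whose last letter is `1`. -/
def endsInOne : Set M := {w | (toList w).getLast? = some 1}

theorem mem_endsInOne_mul {u v : M} :
    u * v ∈ endsInOne ↔ v ∈ endsInOne ∨ (v = 1 ∧ u ∈ endsInOne) := by
  by_cases hv : v = 1
  · simp [hv, endsInOne]
  · have : toList v ≠ [] := hv
    simp [endsInOne, hv, List.getLast?_append_of_ne_nil _ this]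

theorem synCon_endsInOne_mul_self (s : M) : synCon endsInOne s (s * s) := by
  intro f a b
  simp only [mem_endsInOne_mul, map_mul]
  have : f s * f s = 1 ↔ f s = 1 := by
    rw [← FreeMonoid.length_eq_zero, ← FreeMonoid.length_eq_zero, FreeMonoid.length_mul]
    omega
  tauto

theorem occ_pos_of_mem_endsInOne {w : M} (h : w ∈ endsInOne) : occ 1 w ≠ 0 :=
  mem_iff_occ.1 (List.mem_of_getLast? h)

theorem synCon_sq_mul_sq (k : ℕ) :
    synCon {w | occ 1 w = 1 ∧ w ∈ endsInOne} ((x ^ k * y) * (x ^ k * y))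
      ((y * x ^ k) * (y * x ^ k)) := by
  intro f a b
  set s := f (x ^ k * y) with hs
  set t := f (y * x ^ k) with ht
  have hocc : occ 1 s = occ 1 t := by simp [hs, ht, add_comm]
  have hlen : s.length = t.length := by simp [hs, ht, add_comm]
  have hone : s = 1 ↔ t = 1 := by
    rw [← FreeMonoid.length_eq_zero, ← FreeMonoid.length_eq_zero, hlen]
  have hs' : occ 1 s = 0 → s ∉ endsInOne := fun h h' => occ_pos_of_mem_endsInOne h' h
  have ht' : occ 1 t = 0 → t ∉ endsInOne := fun h h' => occ_pos_of_mem_endsInOne h' h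
  simp only [map_mul _ (x ^ k * y), map_mul _ (y * x ^ k), ← hs, ← ht, Set.mem_ofPred_eq, occ_mul,
    mem_endsInOne_mul, ← hocc]
  refine and_congr_right fun h => ?_
  have h₀ : occ 1 s = 0 := by omega
  have h₁ := hs' h₀
  have h₂ := ht' (hocc ▸ h₀)
  have h₃ : s * s = 1 ↔ s = 1 := by simp [← FreeMonoid.length_eq_zero]
  have h₄ : t * t = 1 ↔ t = 1 := by simp [← FreeMonoid.length_eq_zero]
  simp only [h₁, h₂, hone, h₃, h₄]

/-- An upper-modular congruence that preserves linear letters does not make powers central. -/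
theorem IsUpperModularElem.not_rel_pow_mul {c : Con M} (hc : FullyInvariant c)
    (hupper : IsUpperModularElem c) (hc₁ : ∀ u v, c u v → occ 1 u = 1 → occ 1 v = 1)
    {k : ℕ} (hk : k ≠ 0) : ¬ c (x ^ k * y) (y * x ^ k) := by
  intro h
  have hd := fullyInvariant_synCon endsInOne
  have hb := hc.inf (fullyInvariant_synCon {w | occ 1 w = 1 ∧ w ∈ endsInOne})
  have hmem := hupper.mem_of_rel hb hd inf_le_left
    (S := {w | occ 1 w = 1 ∧ w ∈ endsInOne}) (fun u v huv => mem_of_synCon (And.right huv))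
    (fun u v huv huv' hu => ⟨hc₁ u v huv hu.1, mem_of_synCon huv' hu.2⟩) h ?_
    ⟨by simp [x, y], by simp [endsInOne, y]⟩
  · obtain ⟨k, rfl⟩ := Nat.exists_eq_succ_of_ne_zero hk
    have := hmem.2
    simp [pow_succ, mem_endsInOne_mul, ← mul_assoc] at this
    simp [endsInOne, x] at this
  · exact Con.trans _ (sup_right_apply (synCon_endsInOne_mul_self _))
      (Con.trans _ (sup_left_apply ⟨c.mul h h, synCon_sq_mul_sq k⟩)
        (sup_right_apply (Con.symm _ (synCon_endsInOne_mul_self _))))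

theorem synCon_setOf_prefix_pow (u z : M) {p q : ℕ} (hp : u.length < p) (hq : u.length < q) :
    synCon {w | toList u <+: toList w} (z ^ p) (z ^ q) := by
  have key : ∀ (s a b : M) (m : ℕ), s ≠ 1 → u.length < m →
      (toList u <+: toList (a * s ^ m * b) ↔ toList u <+: toList (a * s ^ u.length)) := by
    intro s a b m hs hm
    have h : u.length ≤ (a * s ^ u.length).length := by
      rw [FreeMonoid.length_mul, length_pow]
      nlinarith [one_le_length hs]
    rw [← Nat.add_sub_cancel' hm.le, pow_add, ← mul_assoc, mul_assoc _ _ b, FreeMonoid.toList_mul]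
    exact ⟨fun h' => List.prefix_of_prefix_length_le h' (List.prefix_append _ _) h,
      fun h' => h'.trans (List.prefix_append _ _)⟩
  intro f a b
  by_cases hz : f z = 1
  · simp [hz]
  · simp only [map_pow, Set.mem_ofPred_eq]
    rw [key _ _ _ _ hz hp, key _ _ _ _ hz hq]

/-- The endomorphism erasing the letter `j`. -/
def erase (j : ℕ) : M →* M := FreeMonoid.lift fun i => if i = j then 1 else of i

theorem hom_erase {f : M →* M} {j : ℕ} (h : f (of j) = 1) (w : M) : f (erase j w) = f w := by
  have : f.comp (erase j) = f := by
    ext i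
    by_cases hi : i = j <;> simp [erase, hi, h]
  exact DFunLike.congr_fun this w

theorem length_le_of_forall_ne_one {f : M →* M} {w : M} (h : ∀ j ∈ toList w, f (of j) ≠ 1) :
    w.length ≤ (f w).length := by
  induction w using FreeMonoid.inductionOn' with
  | one => simp
  | of_mul j w ih =>
    have h₁ := ih fun i hi => h i (by simp [hi])
    have h₂ := one_le_length (h j (by simp))
    simp only [map_mul, FreeMonoid.length_mul, FreeMonoid.length_of]
    omega

theorem length_erase_le (j : ℕ) (w : M) : (erase j w).length ≤ w.length := by
  induction w using FreeMonoid.inductionOn' with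
  | one => simp
  | of_mul i w ih =>
    by_cases hi : i = j <;> simp [erase, hi] at ih ⊢ <;> omega

theorem length_erase_lt {j : ℕ} {w : M} (h : j ∈ toList w) : (erase j w).length < w.length := by
  induction w using FreeMonoid.inductionOn' with
  | one => simp at h
  | of_mul i w ih =>
    have hle := length_erase_le j w
    by_cases hi : i = j
    · simp [erase, hi] at hle ⊢
      omega
    · have hj : j ∈ toList w := by simpa [Ne.symm hi] using h
      have := ih hj
      simp [erase, hi] at this ⊢
      omega

/-- An upper-modular congruence all of whose pairs are balanced is trivial. -/
theorem IsUpperModularElem.eq_bot {c : Con M} (hc : FullyInvariant c)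
    (hupper : IsUpperModularElem c) (hbal : ∀ u v, c u v → ∀ i, occ i u = occ i v) : c = ⊥ := by
  have hlen : ∀ u v, c u v → u.length = v.length := fun u v h =>
    (List.perm_iff_count.2 (hbal u v h)).length_eq
  suffices h : ∀ n, ∀ u v, c u v → u.length = n → u = v from
    le_bot_iff.1 fun u v huv => h _ u v huv rfl
  intro n
  induction n using Nat.strong_induction_on with
  | _ n ih =>
  intro u v huv hn
  by_cases hu : u = 1
  · have := hlen u v huv
    rw [hu] at this ⊢
    exact (FreeMonoid.length_eq_zero.1 (by simpa using this.symm)).symm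
  obtain ⟨z, hz⟩ := List.exists_mem_of_ne_nil (toList u) hu
  set p := u.length + 1 with hp
  set q := u.length + p + 1 with hq
  set U := u * of z ^ p with hU
  have hUlen : U.length = u.length + p := by simp [hU]
  have hbc : c (u * of z ^ q) (v * of z ^ q) := c.mul huv (c.refl _)
  have hb : synCon {U} (u * of z ^ q) (v * of z ^ q) := by
    refine synCon_of_lt_length (N := U.length) (by simp) fun f => ?_
    by_cases hf : ∃ j ∈ toList u, f (of j) = 1
    · obtain ⟨j, hj, hfj⟩ := hf
      left
      have := ih _ (hn ▸ length_erase_lt hj) _ _ (hc (erase j) u v huv) rfl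
      rw [map_mul, map_mul, ← hom_erase hfj u, ← hom_erase hfj v, this]
    · right
      push Not at hf
      have h₁ := length_le_of_forall_ne_one hf
      have h₂ := hlen _ _ (hc f u v huv)
      have h₃ := one_le_length (hf z hz)
      have h₄ := Nat.le_mul_of_pos_right q h₃
      simp only [map_mul, map_pow, FreeMonoid.length_mul, length_pow]
      omega
  have hd := synCon_setOf_prefix_pow u (of z) (p := p) (q := q) (by omega) (by omega)
  have hmem := hupper.mem_of_rel (S := {U}) (hc.inf (fullyInvariant_synCon {U}))
    (fullyInvariant_synCon {w | toList u <+: toList w}) inf_le_left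
    (fun _ _ h => mem_of_synCon (And.right h)) ?_ (c.mul huv (c.refl (of z ^ p)))
    (Con.trans _ (sup_right_apply (Con.mul _ (Con.refl _ u) hd)) (Con.trans _
      (sup_left_apply ⟨hbc, hb⟩)
      (sup_right_apply (Con.symm _ (Con.mul _ (Con.refl _ v) hd))))) rfl
  · exact (mul_right_cancel (hmem : v * of z ^ p = u * of z ^ p)).symm
  · rintro _ w hcw hdw rfl
    have hpre : toList u <+: toList w :=
      mem_of_synCon (S := {w | toList u <+: toList w}) hdw (List.prefix_append _ _)
    obtain ⟨w', hw'⟩ := hpre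
    obtain rfl : w = u * FreeMonoid.ofList w' := hw'.symm
    have hperm : w'.Perm (List.replicate p z) := by
      rw [List.perm_iff_count]
      intro i
      have h₁ := hbal _ _ hcw i
      rw [hU, occ_mul, occ_mul, Nat.add_left_cancel_iff, occ_pow, occ_of] at h₁
      rw [List.count_replicate]
      change _ = List.count i w' at h₁
      rw [← h₁]
      by_cases hi : z = i <;> simp [hi]
    rw [List.perm_replicate] at hperm
    have hpow : ∀ m, of z ^ m = FreeMonoid.ofList (List.replicate m z) := by
      intro m
      induction m with
      | zero => rfl
      | succ m ih => rw [pow_succ', ih]; rfl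
    rw [Set.mem_singleton_iff, hperm, hU, hpow]

end UpperModular

/-! ### Classification -/

section Classification

theorem eq_thetaSL_or_eq_top {c : Con M} (hc : FullyInvariant c) (h : thetaSL ≤ c) :
    c = thetaSL ∨ c = ⊤ := by
  by_cases hle : c ≤ thetaSL
  · exact .inl (le_antisymm hle h)
  · right
    rw [← sup_thetaSL_eq_top hc hle, sup_eq_left.2 h]

theorem classification {c : Con M} (hc : FullyInvariant c) (hmod : IsModularElem c)
    (hupper : IsUpperModularElem c) : c = ⊥ ∨ c = thetaSL ∨ c = ⊤ := by
  by_cases hbal : ∀ u v, c u v → ∀ i, occ i u = occ i v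
  · exact .inl (hupper.eq_bot hc hbal)
  right
  have hex : ∃ k, ∃ r, r ≠ 0 ∧ c (x ^ k) (x ^ (k + r)) := by
    push Not at hbal
    obtain ⟨u, v, huv, i, hi⟩ := hbal
    have h := hc.pow_occ huv i x
    rcases Nat.lt_or_gt_of_ne hi with hi | hi
    · exact ⟨occ i u, occ i v - occ i u, by omega, by rwa [Nat.add_sub_cancel' hi.le]⟩
    · exact ⟨occ i v, occ i u - occ i v, by omega, by
        rw [Nat.add_sub_cancel' hi.le]; exact c.symm h⟩
  classical
  obtain ⟨r, hr, h⟩ := Nat.find_spec hex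
  set k := Nat.find hex with hk
  have hmin : ∀ m < k, ∀ s, s ≠ 0 → ¬ c (x ^ m) (x ^ (m + s)) := fun m hm s hs h' =>
    Nat.find_min hex hm ⟨s, hs, h'⟩
  rcases Nat.lt_or_ge k 2 with hk₂ | hk₂
  · have h₁ : c (x ^ 1) (x ^ (1 + r)) := by
      have h' := c.mul (c.refl (x ^ (1 - k))) h
      rwa [← pow_add, ← pow_add, show 1 - k + k = 1 by omega,
        show 1 - k + (k + r) = 1 + r by omega] at h'
    have hcomm : c (x * y) (y * x) := by
      simpa using hmod.rel_pow_mul one_ne_zero hr h₁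
    exact eq_thetaSL_or_eq_top hc
      ((thetaSL_le_iff hc).2 ⟨hmod.rel_mul_self hc hr h₁ hcomm, hcomm⟩)
  · refine absurd (hmod.rel_pow_mul (by omega) hr h)
      (hupper.not_rel_pow_mul hc (fun u v huv hu => ?_) (by omega))
    by_contra hv
    have h' := hc.pow_occ huv 1 x
    rw [hu] at h'
    rcases Nat.lt_or_gt_of_ne hv with hv | hv
    · obtain hv : occ 1 v = 0 := by omega
      rw [hv] at h'
      exact hmin 0 (by omega) 1 one_ne_zero (c.symm h')
    · refine hmin 1 (by omega) (occ 1 v - 1) (by omega) ?_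
      rwa [Nat.add_sub_cancel' hv.le]

end Classification

/-- Main theorem (dual rendering): for a fully invariant congruence `c` on the
free monoid, the following are equivalent: (i) `c` is a modular and
upper-modular element; (ii) `c` is a costandard element; (iii) `c` is a neutral
element; (iv) `c ∈ {⊥, θ_SL, ⊤}`. -/
theorem main_result (c : Con M) (hc : FullyInvariant c) :
    List.TFAE
      [IsModularElem c ∧ IsUpperModularElem c,
       IsCostandardElem c,
       IsNeutralElem c,
       c = ⊥ ∨ c = thetaSL ∨ c = ⊤] := by
  tfae_have 1 → 4 := fun h => classification hc h.1 h.2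
  tfae_have 4 → 2 := by
    rintro (rfl | rfl | rfl)
    · intro b d _ _
      rw [bot_inf_eq, bot_sup_eq, inf_eq_left.2 le_sup_right]
    · exact isCostandardElem_thetaSL
    · intro b d _ _
      rw [top_inf_eq, top_sup_eq, top_inf_eq]
  tfae_have 4 → 3 := by
    rintro (rfl | rfl | rfl)
    · intro b d _ _
      rw [bot_inf_eq, bot_sup_eq, bot_sup_eq, inf_bot_eq, sup_bot_eq, sup_bot_eq,
        inf_eq_left.2 (le_sup_left : b ≤ b ⊔ d)]
    · exact isNeutralElem_thetaSL
    · intro b d _ _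
      rw [top_inf_eq, top_sup_eq, top_inf_eq, sup_top_eq, inf_top_eq, inf_top_eq,
        sup_eq_left.2 (inf_le_left : b ⊓ d ≤ b)]
  tfae_have 2 → 1 := fun h => ⟨h.isModularElem, h.isUpperModularElem⟩
  tfae_have 3 → 1 := fun h => ⟨h.isModularElem, h.isUpperModularElem⟩
  tfae_finish
end

section
/- Every costandard element of the lattice L of fully invariant congruences on the free monoid FreeMonoid ℕ is a standard element of L. (Dual rendering of the paper's corollary: every standard element of the lattice 𝕄𝕆ℕ of monoid varieties is costandard.) -/
/-- `c` is a standard element of the lattice of fully invariant congruences. -/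
def IsStandardElem (c : Con M) : Prop :=
  ∀ b d : Con M, FullyInvariant b → FullyInvariant d →
    (c ⊔ b) ⊓ d = (c ⊓ d) ⊔ (b ⊓ d)

/-- The number of occurrences of the letter `z` in the word `w`. -/
def cnt (z : ℕ) (w : M) : ℕ := w.toList.count z

@[simp] theorem cnt_one (z : ℕ) : cnt z 1 = 0 := by simp [cnt]

@[simp] theorem cnt_mul (z : ℕ) (u v : M) : cnt z (u * v) = cnt z u + cnt z v := by
  simp [cnt]

theorem cnt_of (z a : ℕ) : cnt z (FreeMonoid.of a) = if a = z then 1 else 0 := by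
  simp [cnt, List.count_singleton]

@[simp] theorem cnt_pow (z n : ℕ) (u : M) : cnt z (u ^ n) = n * cnt z u := by
  induction n with
  | zero => simp
  | succ n ih => rw [pow_succ, cnt_mul, ih]; ring

theorem eq_one_of_cnt {w : M} (h : ∀ z, cnt z w = 0) : w = 1 := by
  induction w using FreeMonoid.inductionOn' with
  | one => rfl
  | of_mul a w _ => have := h a; simp [cnt_of] at this

theorem eq_one_or_of_of_cnt {a : ℕ} {w : M} (ha : cnt a w ≤ 1) (h : ∀ z, z ≠ a → cnt z w = 0) :
    w = 1 ∨ w = FreeMonoid.of a := by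
  induction w using FreeMonoid.inductionOn' with
  | one => exact Or.inl rfl
  | of_mul b w _ =>
    right
    have hb : b = a := by
      by_contra hne
      have := h b hne
      simp [cnt_of] at this
    subst hb
    have hw : w = 1 := by
      refine eq_one_of_cnt fun z => ?_
      by_cases hz : z = b
      · subst hz; simp [cnt_of] at ha; exact ha
      · have := h z hz
        rw [cnt_mul] at this; omega
    rw [hw, mul_one]

/-- The words over the two letters `x` and `y`. -/
def Binary (u : M) : Prop := ∀ z, 2 ≤ z → cnt z u = 0

theorem Binary.induction {P : M → Prop} {u : M} (hu : Binary u) (one : P 1)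
    (hx : ∀ w, P w → P (x * w)) (hy : ∀ w, P w → P (y * w)) : P u := by
  induction u using FreeMonoid.inductionOn' with
  | one => exact one
  | of_mul a w ih =>
    have hw : Binary w := fun z hz => by have := hu z hz; rw [cnt_mul] at this; omega
    have ha : a = 0 ∨ a = 1 := by
      by_contra hne
      have := hu a (by omega)
      simp [cnt_of] at this
    rcases ha with rfl | rfl
    · exact hx w (ih hw)
    · exact hy w (ih hw)

@[simp] theorem cnt_x (z : ℕ) : cnt z x = if z = 0 then 1 else 0 := by
  rw [x, cnt_of]; simp [eq_comm]

@[simp] theorem cnt_y (z : ℕ) : cnt z y = if z = 1 then 1 else 0 := by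
  rw [y, cnt_of]; simp [eq_comm]

theorem Binary.cnt_map {u : M} (hu : Binary u) (f : M →* M) (z : ℕ) :
    cnt z (f u) = cnt 0 u * cnt z (f x) + cnt 1 u * cnt z (f y) := by
  refine hu.induction (P := fun u => cnt z (f u) = cnt 0 u * cnt z (f x) + cnt 1 u * cnt z (f y))
    ?_ (fun w ih => ?_) (fun w ih => ?_)
  · simp
  · simp [ih]; ring
  · simp [ih]; ring

theorem Binary.map_eq_pow_y {u : M} (hu : Binary u) {f : M →* M} (hf : f x = 1) :
    f u = f y ^ cnt 1 u := by
  refine hu.induction (P := fun u => f u = f y ^ cnt 1 u) ?_ (fun w ih => ?_) (fun w ih => ?_)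
  · simp
  · simp [ih, hf]
  · simp [ih, pow_add]

theorem Binary.map_eq_pow_x {u : M} (hu : Binary u) {f : M →* M} (hf : f y = 1) :
    f u = f x ^ cnt 0 u := by
  refine hu.induction (P := fun u => f u = f x ^ cnt 0 u) ?_ (fun w ih => ?_) (fun w ih => ?_)
  · simp
  · simp [ih, pow_add]
  · simp [ih, hf]

theorem Binary.map_eq_self {u : M} (hu : Binary u) {f : M →* M} (hx : f x = x) (hy : f y = y) :
    f u = u := by
  refine hu.induction (P := fun u => f u = u) ?_ (fun w ih => ?_) (fun w ih => ?_)
  · simp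
  · simp [ih, hx]
  · simp [ih, hy]

theorem eq_one_of_mul_y_mul_eq {p s r : M} (h : p * (y * s) = y * r) (hp : cnt 1 p = 0) : p = 1 := by
  induction p using FreeMonoid.inductionOn' with
  | one => rfl
  | of_mul a w _ =>
    have h0 : a :: (w.toList ++ (y * s).toList) = 1 :: r.toList := h
    have : a = 1 := (List.cons.inj h0).1
    subst this
    simp [cnt_of] at hp

theorem eq_one_of_mul_y_mul_eq' {q s r : M} (h : s * y * q = r * y) (hq : cnt 1 q = 0) : q = 1 := by
  have h0 : s.toList ++ [1] ++ q.toList = r.toList ++ [1] := h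
  rcases List.eq_nil_or_concat q.toList with h1 | ⟨l, a, h1⟩
  · exact h1
  · rw [h1, List.concat_eq_append, ← List.append_assoc] at h0
    have := (List.append_inj' h0 rfl).2
    simp only [List.cons.injEq, and_true] at this
    subst this
    simp [cnt, h1] at hq

/-- A power of `x` that is a factor of `A * y * B` is a factor of `A` or of `B`. -/
theorem le_cnt_of_pow_factor {p q A B : M} {m : ℕ} (h : p * x ^ m * q = A * (y * B)) :
    m ≤ cnt 0 A ∨ m ≤ cnt 0 B := by
  have hx : (x ^ m).toList = List.replicate m 0 := by
    clear h
    induction m with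
    | zero => rfl
    | succ m ih => rw [pow_succ', FreeMonoid.toList_mul, ih]; rfl
  have h0 : p.toList ++ (List.replicate m 0 ++ q.toList) = A.toList ++ (1 :: B.toList) := by
    rw [← hx, ← List.append_assoc]; exact h
  rcases List.append_eq_append_iff.1 h0 with ⟨a, ha, hb⟩ | ⟨a, ha, hb⟩
  · rcases List.append_eq_append_iff.1 hb with ⟨c, hc, hd⟩ | ⟨c, hc, hd⟩
    · left
      simp [cnt, ha, hc]; omega
    · rcases c with _ | ⟨d, c⟩
      · left
        rw [List.append_nil] at hc
        simp [cnt, ha, ← hc]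
      · have hd1 : (1 : ℕ) = d := by simpa using congrArg List.head? hd
        have : (1 : ℕ) ∈ List.replicate m 0 := by rw [hc, ← hd1]; simp
        simp [List.mem_replicate] at this
  · right
    have := congrArg (List.count 0) hb
    simp at this
    simp [cnt]; omega

theorem eq_of_factor_image {f : M →* M} {p q l R : M} {K L : ℕ} (hL : 3 ≤ L) (hK : L + 3 ≤ K)
    (h : p * f l * q = R)
    (hl : ∀ z, K * cnt z (f x) + L * cnt z (f y) ≤ cnt z (f l))
    (hR0 : cnt 0 R ≤ K + 1) (hR1 : cnt 1 R = L) (hR2 : ∀ z, 2 ≤ z → cnt z R ≤ 1)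
    (hlx : f x = x → f y = 1 → ∃ s s', f l = s * x ^ (K - 1) * s')
    (hRx : ∀ p q, p * x ^ (K - 1) * q ≠ R)
    (hls : f y = y → ∃ s, f l = y * s) (hle : f y = y → ∃ s, f l = s * y)
    (hRs : ∃ s, R = y * s) (hRe : ∃ s, R = s * y) :
    f x = 1 ∨ p = 1 ∧ q = 1 ∧ f x = x ∧ f y = y ∧ f l = R := by
  have hcnt : ∀ z, cnt z p + (K * cnt z (f x) + L * cnt z (f y)) + cnt z q ≤ cnt z R := by
    intro z
    have := hl z
    rw [← h]; simp; omega
  have hX : f x = 1 ∨ f x = x := by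
    refine eq_one_or_of_of_cnt ?_ fun z hz => ?_
    · have := hcnt 0
      by_contra hc
      have : K * 2 ≤ K * cnt 0 (f x) := Nat.mul_le_mul_left _ (by omega)
      omega
    · have := hcnt z
      by_contra hc
      have : K * 1 ≤ K * cnt z (f x) := Nat.mul_le_mul_left _ (by omega)
      rcases (by omega : z = 1 ∨ 2 ≤ z) with rfl | hz
      · omega
      · have := hR2 z hz
        omega
  rcases hX with hX | hX
  · exact Or.inl hX
  right
  have hY : f y = 1 ∨ f y = y := by
    refine eq_one_or_of_of_cnt ?_ fun z hz => ?_
    · have := hcnt 1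
      by_contra hc
      have : L * 2 ≤ L * cnt 1 (f y) := Nat.mul_le_mul_left _ (by omega)
      omega
    · have := hcnt z
      by_contra hc
      have : L * 1 ≤ L * cnt z (f y) := Nat.mul_le_mul_left _ (by omega)
      rcases (by omega : z = 0 ∨ 2 ≤ z) with rfl | hz
      · have hx0 : cnt 0 (f x) = 1 := by simp [hX]
        have h0 := hcnt 0
        rw [hx0] at h0
        omega
      · have := hR2 z hz
        omega
  rcases hY with hY | hY
  · obtain ⟨s, s', hs⟩ := hlx hX hY
    exact absurd (by rw [← h, hs]; simp only [mul_assoc]) (hRx (p * s) (s' * q))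
  · have h1 := hcnt 1
    rw [hX, hY] at h1
    simp at h1
    obtain ⟨s, hs⟩ := hls hY
    obtain ⟨s', hs'⟩ := hle hY
    obtain ⟨r, hr⟩ := hRs
    obtain ⟨r', hre⟩ := hRe
    have hp : p = 1 := by
      refine eq_one_of_mul_y_mul_eq (s := s * q) (r := r) ?_ (by omega)
      rw [← hr, ← h, hs]; simp only [mul_assoc]
    have hq : q = 1 := by
      refine eq_one_of_mul_y_mul_eq' (s := p * s') (r := r') ?_ (by omega)
      rw [← hre, ← h, hs']; simp only [mul_assoc]
    refine ⟨hp, hq, hX, hY, ?_⟩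
    rw [← h, hp, hq, one_mul, mul_one]

/-- A letter different from `x` and `y`. -/
def t : M := FreeMonoid.of 2

@[simp] theorem cnt_t (z : ℕ) : cnt z t = if z = 2 then 1 else 0 := by
  rw [t, cnt_of]; simp [eq_comm]

/-- A word with the factor `u` in which `x` precedes the letter `t`. -/
def leftWord (n : ℕ) (u : M) : M := y * x ^ n * y * x * u * x * t * y

/-- A word obtained from `leftWord n u` by moving `x` behind `t` and doubling it. -/
def rightWord (n : ℕ) (u : M) : M := y * x ^ n * y * x * u * t * (x * x) * y

section Words

variable {n : ℕ} {u v : M} (hu : Binary u)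
include hu

theorem map_leftWord_eq_of_map_x {f : M →* M} (hf : f x = 1) (hv : Binary v)
    (h1 : cnt 1 v = cnt 1 u) : f (leftWord n v) = f (rightWord n u) := by
  simp [leftWord, rightWord, hf, hu.map_eq_pow_y hf, hv.map_eq_pow_y hf, h1]

theorem eq_of_factor_word {R : M} (hn : cnt 1 u + 4 ≤ n) (hv : Binary v) (h0 : cnt 0 v = cnt 0 u)
    (h1 : cnt 1 v = cnt 1 u) (hR : R = leftWord n u ∨ R = rightWord n u) {f : M →* M} {p q l : M}
    (hl : l = leftWord n v ∨ l = rightWord n u) (h : p * f l * q = R) :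
    f x = 1 ∨ p = 1 ∧ q = 1 ∧ f x = x ∧ f y = y ∧ f l = R := by
  refine eq_of_factor_image (K := n + 2 + cnt 0 u) (L := 3 + cnt 1 u) (by omega) (by omega) h
    ?_ ?_ ?_ ?_ ?_ ?_ ?_ ?_ ?_ ?_
  · intro z
    rcases hl with rfl | rfl
    · simp [leftWord, hv.cnt_map, h0, h1]; nlinarith
    · simp [rightWord, hu.cnt_map]; nlinarith
  · rcases hR with rfl | rfl <;> simp [leftWord, rightWord]
  · rcases hR with rfl | rfl <;> simp [leftWord, rightWord] <;> omega
  · intro z hz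
    have := hu z hz
    rcases hR with rfl | rfl <;>
      simp only [leftWord, rightWord, this, cnt_mul, cnt_pow, cnt_x, cnt_y, cnt_t] <;>
      split_ifs <;> omega
  · intro hX hY
    rcases hl with rfl | rfl
    · refine ⟨1, x * f t, ?_⟩
      simp only [leftWord, map_mul, map_pow, hv.map_eq_pow_x hY, hX, hY, h0, one_mul, mul_one]
      rw [show n + 2 + cnt 0 u - 1 = n + 1 + cnt 0 u by omega, pow_add, pow_add, pow_one]
      simp only [mul_assoc]
    · refine ⟨1, f t * (x * x), ?_⟩
      simp only [rightWord, map_mul, map_pow, hu.map_eq_pow_x hY, hX, hY, one_mul, mul_one]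
      rw [show n + 2 + cnt 0 u - 1 = n + 1 + cnt 0 u by omega, pow_add, pow_add, pow_one]
      simp only [mul_assoc]
  · intro p q hpq
    rcases hR with rfl | rfl
    · have := le_cnt_of_pow_factor (A := y * x ^ n) (B := x * u * x * t * y)
        (hpq.trans (by simp only [leftWord, mul_assoc]))
      simp at this; omega
    · have := le_cnt_of_pow_factor (A := y * x ^ n) (B := x * u * t * (x * x) * y)
        (hpq.trans (by simp only [rightWord, mul_assoc]))
      simp at this; omega
  · intro hY
    rcases hl with rfl | rfl
    · exact ⟨f (x ^ n * y * x * v * x * t * y), by simp [leftWord, hY, mul_assoc]⟩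
    · exact ⟨f (x ^ n * y * x * u * t * (x * x) * y), by simp [rightWord, hY, mul_assoc]⟩
  · intro hY
    rcases hl with rfl | rfl
    · exact ⟨f (y * x ^ n * y * x * v * x * t), by simp [leftWord, hY, mul_assoc]⟩
    · exact ⟨f (y * x ^ n * y * x * u * t * (x * x)), by simp [rightWord, hY, mul_assoc]⟩
  · rcases hR with rfl | rfl
    · exact ⟨x ^ n * y * x * u * x * t * y, by simp [leftWord, mul_assoc]⟩
    · exact ⟨x ^ n * y * x * u * t * (x * x) * y, by simp [rightWord, mul_assoc]⟩
  · rcases hR with rfl | rfl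
    · exact ⟨y * x ^ n * y * x * u * x * t, by simp [leftWord, mul_assoc]⟩
    · exact ⟨y * x ^ n * y * x * u * t * (x * x), by simp [rightWord, mul_assoc]⟩

theorem map_leftWord_eq_self (f : M →* M) (hX : f x = x) (hY : f y = y) (hT : f t = t) :
    f (leftWord n u) = leftWord n u := by
  simp [leftWord, hX, hY, hT, hu.map_eq_self hX hY]

theorem map_rightWord_eq_self (f : M →* M) (hX : f x = x) (hY : f y = y) (hT : f t = t) :
    f (rightWord n u) = rightWord n u := by
  simp [rightWord, hX, hY, hT, hu.map_eq_self hX hY]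

theorem eq_of_map_leftWord_eq_leftWord (hv : Binary v) (h0 : cnt 0 v = cnt 0 u)
    (h1 : cnt 1 v = cnt 1 u) {f : M →* M} (hX : f x = x) (hY : f y = y)
    (h : f (leftWord n v) = leftWord n u) : v = u ∧ f t = t := by
  simp only [leftWord, map_mul, map_pow, hX, hY, hv.map_eq_self hX hY] at h
  have hc : ∀ z, cnt z (f t) = cnt z t := by
    intro z
    have := congrArg (cnt z) h
    have hz : cnt z v = cnt z u := by
      rcases (by omega : z = 0 ∨ z = 1 ∨ 2 ≤ z) with rfl | rfl | hz
      · exact h0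
      · exact h1
      · rw [hu z hz, hv z hz]
    simp only [cnt_mul, hz] at this
    omega
  have hT : f t = t := by
    rcases eq_one_or_of_of_cnt (a := 2) (w := f t) (by simp [hc])
      (fun z hz => by simp [hc, hz]) with h | h
    · have := hc 2
      simp [h] at this
    · exact h
  refine ⟨?_, hT⟩
  rw [hT] at h
  simpa [mul_assoc] using h

theorem map_leftWord_ne_rightWord {f : M →* M} (hX : f x = x) (hY : f y = y) :
    f (leftWord n u) ≠ rightWord n u := by
  intro h
  simp only [leftWord, rightWord, map_mul, map_pow, hX, hY, hu.map_eq_self hX hY, mul_assoc,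
    mul_right_inj] at h
  have := congrArg (fun w : M => w.toList.head?) h
  simp [x, t] at this

theorem eq_of_map_rightWord_eq_rightWord {f : M →* M} (hX : f x = x) (hY : f y = y)
    (h : f (rightWord n u) = rightWord n u) : f t = t := by
  simp only [rightWord, map_mul, map_pow, hX, hY, hu.map_eq_self hX hY] at h
  simpa using h

theorem map_rightWord_ne_leftWord {f : M →* M} (hX : f x = x) (hY : f y = y) :
    f (rightWord n u) ≠ leftWord n u := by
  intro h
  have := congrArg (cnt 0) h
  simp [rightWord, leftWord, hX, hY, hu.map_eq_self hX hY] at this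
  omega

end Words

/-- Two words are related if no substitution and no context separates them by membership
in `S`. -/
def substCon (S : Set M) : Con M where
  r u v := ∀ (f : M →* M) (p q : M), p * f u * q ∈ S ↔ p * f v * q ∈ S
  iseqv := ⟨fun _ _ _ _ => Iff.rfl, fun h f p q => (h f p q).symm,
    fun h h' f p q => (h f p q).trans (h' f p q)⟩
  mul' := by
    intro a b c d h h' f p q
    have h1 := h f p (f c * q)
    have h2 := h' f (p * f b) q
    simp only [map_mul, mul_assoc] at *
    exact h1.trans h2

/-- The syntactic congruence of `S`. -/
def syntacticCon (S : Set M) : Con M where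
  r u v := ∀ p q : M, p * u * q ∈ S ↔ p * v * q ∈ S
  iseqv := ⟨fun _ _ _ => Iff.rfl, fun h p q => (h p q).symm,
    fun h h' p q => (h p q).trans (h' p q)⟩
  mul' := by
    intro a b c d h h' p q
    have h1 := h p (c * q)
    have h2 := h' (p * b) q
    simp only [mul_assoc] at *
    exact h1.trans h2

/-- `S` is a union of classes of the congruence `c`. -/
def Saturated (S : Set M) (c : Con M) : Prop := ∀ u v, c u v → (u ∈ S ↔ v ∈ S)

theorem Saturated.sup {S : Set M} {c d : Con M} (hc : Saturated S c) (hd : Saturated S d) :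
    Saturated S (c ⊔ d) := by
  have h : c ⊔ d ≤ syntacticCon S := by
    refine sup_le ?_ ?_
    · exact fun u v h p q => hc _ _ (c.mul (c.mul (c.refl p) h) (c.refl q))
    · exact fun u v h p q => hd _ _ (d.mul (d.mul (d.refl p) h) (d.refl q))
  intro u v huv
  simpa using h huv 1 1

/-- The fully invariant congruence generated by a pair of words. -/
abbrev gen (l r : M) : Con M := fiClosure {(l, r)}

theorem fullyInvariant_gen (l r : M) : FullyInvariant (gen l r) := by
  intro f u v h c hc
  exact hc.1 f u v (h c hc)

theorem gen_rel (l r : M) : gen l r l r :=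
  fun _ hc => hc.2 (l, r) rfl

theorem saturated_gen {S : Set M} {l r : M}
    (h : ∀ (f : M →* M) (p q : M), p * f l * q ∈ S ↔ p * f r * q ∈ S) : Saturated S (gen l r) := by
  have hle : gen l r ≤ substCon S := by
    refine sInf_le ⟨fun g u v huv f p q => huv (f.comp g) p q, ?_⟩
    rintro _ rfl
    exact h
  intro u v huv
  simpa using hle huv (MonoidHom.id M) 1 1

theorem rel_sup_left {c d : Con M} {u v : M} (h : c u v) : (c ⊔ d) u v :=
  (le_sup_left : c ≤ c ⊔ d) h

theorem rel_sup_right {c d : Con M} {u v : M} (h : d u v) : (c ⊔ d) u v :=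
  (le_sup_right : d ≤ c ⊔ d) h

theorem IsCostandardElem.rel {a b d : Con M} (h : IsCostandardElem a) (hb : FullyInvariant b)
    (hd : FullyInvariant d) {u v : M} (h1 : (a ⊔ d) u v) (h2 : (b ⊔ d) u v) :
    (a ⊓ b ⊔ d) u v := by
  rw [h b d hb hd]
  exact ⟨h1, h2⟩

theorem saturated_pair_gen {n : ℕ} {u : M} (hu : Binary u) (hn : cnt 1 u + 4 ≤ n) :
    Saturated {leftWord n u, rightWord n u} (gen (leftWord n u) (rightWord n u)) := by
  refine saturated_gen fun f p q => ⟨fun h => ?_, fun h => ?_⟩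
  · rcases eq_of_factor_word hu hn hu rfl rfl h (Or.inl rfl) rfl with hX | ⟨rfl, rfl, hX, hY, hf⟩
    · rwa [← map_leftWord_eq_of_map_x hu hX hu rfl]
    · rw [one_mul, mul_one] at h ⊢
      rcases h with h | h
      · rw [map_rightWord_eq_self hu f hX hY (eq_of_map_leftWord_eq_leftWord hu hu rfl rfl hX hY h).2]
        exact Or.inr rfl
      · exact absurd h (map_leftWord_ne_rightWord hu hX hY)
  · rcases eq_of_factor_word hu hn hu rfl rfl h (Or.inr rfl) rfl with hX | ⟨rfl, rfl, hX, hY, hf⟩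
    · rwa [map_leftWord_eq_of_map_x hu hX hu rfl]
    · rw [one_mul, mul_one] at h ⊢
      rcases h with h | h
      · exact absurd h (map_rightWord_ne_leftWord hu hX hY)
      · rw [map_leftWord_eq_self hu f hX hY (eq_of_map_rightWord_eq_rightWord hu hX hY h)]
        exact Or.inl rfl

theorem saturated_singleton_gen {n : ℕ} {u v : M} (hu : Binary u) (hn : cnt 1 u + 4 ≤ n)
    (hv : Binary v) (h0 : cnt 0 v = cnt 0 u) (h1 : cnt 1 v = cnt 1 u) (hne : u ≠ v) :
    Saturated {leftWord n u} (gen (leftWord n v) (rightWord n u)) := by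
  refine saturated_gen fun f p q => ⟨fun h => ?_, fun h => ?_⟩
  · rcases eq_of_factor_word hu hn hv h0 h1 (Or.inl rfl) (Or.inl rfl) h with
      hX | ⟨rfl, rfl, hX, hY, hf⟩
    · rwa [← map_leftWord_eq_of_map_x hu hX hv h1]
    · exact absurd (eq_of_map_leftWord_eq_leftWord hu hv h0 h1 hX hY hf).1.symm hne
  · rcases eq_of_factor_word hu hn hv h0 h1 (Or.inl rfl) (Or.inr rfl) h with
      hX | ⟨rfl, rfl, hX, hY, hf⟩
    · rwa [map_leftWord_eq_of_map_x hu hX hv h1]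
    · exact absurd hf (map_rightWord_ne_leftWord hu hX hY)

theorem leftWord_ne_rightWord (n : ℕ) (u : M) : leftWord n u ≠ rightWord n u := by
  intro h
  have := congrArg (cnt 0) h
  simp [leftWord, rightWord] at this

section Costandard

variable {a : Con M} (h : IsCostandardElem a)

include h

theorem IsCostandardElem.leftWord_rightWord {u v : M} (hu : Binary u) (hv : Binary v)
    (h0 : cnt 0 v = cnt 0 u) (h1 : cnt 1 v = cnt 1 u) (hne : u ≠ v) (huv : a u v) :
    a (leftWord (cnt 1 u + 4) u) (rightWord (cnt 1 u + 4) u) := by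
  by_contra hcon
  have hLL : a (leftWord (cnt 1 u + 4) u) (leftWord (cnt 1 u + 4) v) := by
    unfold leftWord
    exact a.mul (a.mul (a.mul (a.mul (a.refl _) huv) (a.refl _)) (a.refl _)) (a.refl _)
  have hrel := h.rel (fullyInvariant_gen (leftWord (cnt 1 u + 4) u) (rightWord (cnt 1 u + 4) u))
    (fullyInvariant_gen (leftWord (cnt 1 u + 4) v) (rightWord (cnt 1 u + 4) u))
    (Con.trans _ (rel_sup_left hLL) (rel_sup_right (gen_rel _ _)))
    (rel_sup_left (gen_rel _ _))
  have hsat : Saturated {leftWord (cnt 1 u + 4) u}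
      (a ⊓ gen (leftWord (cnt 1 u + 4) u) (rightWord (cnt 1 u + 4) u)) := by
    have key : ∀ w, a (leftWord (cnt 1 u + 4) u) w →
        gen (leftWord (cnt 1 u + 4) u) (rightWord (cnt 1 u + 4) u) (leftWord (cnt 1 u + 4) u) w →
        w = leftWord (cnt 1 u + 4) u := by
      intro w hw hw'
      rcases (saturated_pair_gen hu le_rfl _ _ hw').1 (Or.inl rfl) with rfl | rfl
      · rfl
      · exact absurd hw hcon
    rintro w w' ⟨hw, hw'⟩
    constructor
    · rintro rfl
      exact key _ hw hw'
    · rintro rfl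
      exact key _ (a.symm hw) (Con.symm _ hw')
  have := ((hsat.sup (saturated_singleton_gen hu le_rfl hv h0 h1 hne)) _ _ hrel).1 rfl
  exact leftWord_ne_rightWord _ _ this.symm

/-- Consequence of `leftWord_rightWord` under a substitution erasing `y`. -/
theorem IsCostandardElem.exists_pow_mul (ha : FullyInvariant a) {u v : M}
    (hu : Binary u) (hv : Binary v) (h0 : cnt 0 v = cnt 0 u) (h1 : cnt 1 v = cnt 1 u) (hne : u ≠ v) (huv : a u v) :
    ∃ K, ∀ g w : M, a (g ^ (K + 1) * w) (g ^ K * w * (g * g)) := by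
  refine ⟨cnt 1 u + 4 + 1 + cnt 0 u, fun g w => ?_⟩
  have := ha (FreeMonoid.lift fun i => if i = 0 then g else if i = 2 then w else 1) _ _
    (h.leftWord_rightWord hu hv h0 h1 hne huv)
  have hX : FreeMonoid.lift (fun i => if i = 0 then g else if i = 2 then w else 1) x = g := by
    simp [x]
  have hY : FreeMonoid.lift (fun i => if i = 0 then g else if i = 2 then w else 1) y = 1 := by
    simp [y]
  have hT : FreeMonoid.lift (fun i => if i = 0 then g else if i = 2 then w else 1) t = w := by
    simp [t]
  simp only [leftWord, rightWord, map_mul, map_pow, hX, hY, hT, hu.map_eq_pow_x hY,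
    one_mul, mul_one] at this
  simpa only [pow_add, pow_one, mul_assoc] using this

end Costandard

/-- The endomorphism that retains only the letters `i` and `j`, renaming them to `x` and `y`. -/
def proj (i j : ℕ) : M →* M :=
  FreeMonoid.lift fun k => if k = i then x else if k = j then y else 1

theorem binary_one : Binary 1 := fun z _ => cnt_one z

theorem binary_x : Binary x := fun z hz => by rw [cnt_x, if_neg (by omega)]

theorem binary_y : Binary y := fun z hz => by rw [cnt_y, if_neg (by omega)]

theorem Binary.mul {u v : M} (hu : Binary u) (hv : Binary v) : Binary (u * v) :=
  fun z hz => by rw [cnt_mul, hu z hz, hv z hz]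

theorem Binary.pow {u : M} (hu : Binary u) (n : ℕ) : Binary (u ^ n) :=
  fun z hz => by rw [cnt_pow, hu z hz, mul_zero]

theorem binary_proj (i j : ℕ) (u : M) : Binary (proj i j u) := by
  induction u using FreeMonoid.inductionOn' with
  | one => rw [map_one]; exact binary_one
  | of_mul a w ih =>
    rw [map_mul]
    refine Binary.mul ?_ ih
    rw [proj, FreeMonoid.lift_eval_of]
    split_ifs
    exacts [binary_x, binary_y, binary_one]

theorem proj_of_left (i j : ℕ) : proj i j (FreeMonoid.of i) = x := by
  simp [proj]

theorem proj_of_right {i j : ℕ} (h : i ≠ j) : proj i j (FreeMonoid.of j) = y := by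
  simp [proj, h.symm]

theorem x_mul_ne_y_mul (u v : M) : x * u ≠ y * v := by
  intro h
  have := congrArg (fun w : M => w.toList.head?) h
  simp [x, y] at this

theorem eq_of_proj_eq {u v : M} (h : ∀ i j, i ≠ j → proj i j u = proj i j v) : u = v := by
  induction u using FreeMonoid.inductionOn' generalizing v with
  | one =>
    cases v using FreeMonoid.casesOn with
    | one => rfl
    | of_mul b w =>
      have := congrArg (cnt 0) (h b (b + 1) (by omega))
      simp [proj_of_left] at this
      omega
  | of_mul a u ih =>
    cases v using FreeMonoid.casesOn with
    | one =>
      have := congrArg (cnt 0) (h a (a + 1) (by omega))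
      simp [proj_of_left] at this
    | of_mul b w =>
      by_cases hab : a = b
      · subst hab
        rw [ih (v := w) fun i j hij => by simpa using h i j hij]
      · have := h a b hab
        rw [map_mul, map_mul, proj_of_left, proj_of_right hab] at this
        exact absurd this (x_mul_ne_y_mul _ _)

theorem eq_of_pow_mul_y_mul_eq {i j : ℕ} {s r : M} (h : x ^ i * (y * s) = x ^ j * (y * r)) :
    i = j := by
  induction i generalizing j with
  | zero =>
    cases j with
    | zero => rfl
    | succ j =>
      rw [pow_zero, one_mul, pow_succ', mul_assoc] at h
      exact absurd h.symm (x_mul_ne_y_mul _ _)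
  | succ i ih =>
    cases j with
    | zero =>
      rw [pow_zero, one_mul, pow_succ', mul_assoc] at h
      exact absurd h (x_mul_ne_y_mul _ _)
    | succ j =>
      rw [pow_succ', pow_succ', mul_assoc, mul_assoc, mul_right_inj] at h
      rw [ih h]

/-- A nontrivial fully invariant congruence relates two distinct binary words with equal
content. -/
theorem exists_balanced {a : Con M} (ha : FullyInvariant a) {u v : M} (huv : a u v)
    (hne : u ≠ v) : ∃ u v, Binary u ∧ Binary v ∧ cnt 0 v = cnt 0 u ∧ cnt 1 v = cnt 1 u ∧
      u ≠ v ∧ a u v := by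
  have of_pow : ∀ i j, i ≠ j → a (x ^ i) (x ^ j) → ∃ u v, Binary u ∧ Binary v ∧
      cnt 0 v = cnt 0 u ∧ cnt 1 v = cnt 1 u ∧ u ≠ v ∧ a u v := by
    intro i j hij hr
    refine ⟨x ^ i * (y * x ^ j), x ^ j * (y * x ^ i), (binary_x.pow i).mul (binary_y.mul
      (binary_x.pow j)), (binary_x.pow j).mul (binary_y.mul (binary_x.pow i)), ?_, ?_, ?_, ?_⟩
    · simp [add_comm]
    · simp
    · exact fun h => hij (eq_of_pow_mul_y_mul_eq h)
    · exact a.mul hr (a.mul (a.refl _) (a.symm hr))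
  obtain ⟨i, j, -, hp⟩ : ∃ i j, i ≠ j ∧ proj i j u ≠ proj i j v := by
    by_contra! hcon
    exact hne (eq_of_proj_eq hcon)
  have hr := ha (proj i j) _ _ huv
  by_cases h0 : cnt 0 (proj i j u) = cnt 0 (proj i j v)
  · by_cases h1 : cnt 1 (proj i j u) = cnt 1 (proj i j v)
    · exact ⟨_, _, binary_proj i j u, binary_proj i j v, h0.symm, h1.symm, hp, hr⟩
    · have hpow := ha (proj 1 2) _ _ hr
      have hX : proj 1 2 x = 1 := by simp [proj, x]
      rw [(binary_proj i j u).map_eq_pow_y hX, (binary_proj i j v).map_eq_pow_y hX,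
        show proj 1 2 y = x from proj_of_left 1 2] at hpow
      exact of_pow _ _ h1 hpow
  · have hpow := ha (proj 0 2) _ _ hr
    have hY : proj 0 2 y = 1 := by simp [proj, y]
    rw [(binary_proj i j u).map_eq_pow_x hY, (binary_proj i j v).map_eq_pow_x hY,
      show proj 0 2 x = x from proj_of_left 0 2] at hpow
    exact of_pow _ _ h0 hpow

/-- The endomorphism sending `x` to `g` and every other letter to `h`. -/
def subst (g h : M) : M →* M := FreeMonoid.lift fun i => if i = 0 then g else h

@[simp] theorem subst_x (g h : M) : subst g h x = g := by simp [subst, x]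

@[simp] theorem subst_y (g h : M) : subst g h y = h := by simp [subst, y]

theorem gen_map (f : M →* M) (l r : M) : gen l r (f l) (f r) :=
  fullyInvariant_gen l r f l r (gen_rel l r)

theorem lift_single (z : ℕ) (g w : M) :
    FreeMonoid.lift (fun k => if k = z then g else 1) w = g ^ cnt z w := by
  induction w using FreeMonoid.inductionOn' with
  | one => simp
  | of_mul a w ih =>
    rw [map_mul, ih, FreeMonoid.lift_eval_of, cnt_mul, cnt_of]
    split_ifs
    · rw [pow_add, pow_one]
    · rw [zero_add, one_mul]

/-- The last letter of a word. -/
def last (w : M) : Option ℕ := w.toList.getLast?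

theorem last_mul (u v : M) : last (u * v) = (last v).or (last u) := by
  simp [last, List.getLast?_append]

theorem cnt_pos_of_last {z : ℕ} {w : M} (h : last w = some z) : 0 < cnt z w :=
  List.count_pos_iff.2 (List.mem_of_getLast? h)

theorem saturated_last :
    Saturated {w | last w = some 2} (gen (y * x) (x * y * x)) := by
  refine saturated_gen fun f p q => ?_
  simp only [Set.mem_ofPred_eq, map_mul, last_mul]
  rcases last q with _ | _ <;> rcases last (f x) with _ | _ <;> simp

theorem saturated_last_of_cnt :
    Saturated {w | cnt 2 w = 1 ∧ last w = some 2} (gen (x * x * (y * y)) (y * y * (x * x))) := by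
  refine saturated_gen fun f p q => ?_
  have hX : last (f x) = some 2 → 0 < cnt 2 (f x) := cnt_pos_of_last
  have hY : last (f y) = some 2 → 0 < cnt 2 (f y) := cnt_pos_of_last
  have hc : cnt 2 (p * f (x * x * (y * y)) * q) = cnt 2 (p * f (y * y * (x * x)) * q) := by
    simp; omega
  simp only [Set.mem_ofPred_eq, hc]
  refine and_congr_right fun h1 => ?_
  simp only [map_mul, cnt_mul] at h1
  have hX' : last (f x) ≠ some 2 := fun h => by have := hX h; omega
  have hY' : last (f y) ≠ some 2 := fun h => by have := hY h; omega
  simp only [map_mul, last_mul]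
  rcases last q with _ | _ <;> rcases hx : last (f x) with _ | _ <;>
    rcases hy : last (f y) with _ | _ <;> simp_all

theorem saturated_singleton_x_mul_y :
    Saturated {x * y} (gen (x * x * (y * y)) (y * y * (x * x))) := by
  refine saturated_gen fun f p q => ?_
  have key : ∀ w, (∀ z, cnt z w = cnt z p + 2 * cnt z (f x) + 2 * cnt z (f y) + cnt z q) →
      w = x * y → f x = 1 ∧ f y = 1 := by
    rintro _ hw rfl
    have hle : ∀ z, cnt z (x * y) ≤ 1 := by
      intro z
      rw [cnt_mul, cnt_x, cnt_y]
      split_ifs <;> omega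
    constructor <;> refine eq_one_of_cnt fun z => ?_ <;> have := hw z <;> have := hle z <;> omega
  constructor
  · intro h
    obtain ⟨hX, hY⟩ := key _ (fun z => by simp; omega) h
    simpa [hX, hY] using h
  · intro h
    obtain ⟨hX, hY⟩ := key _ (fun z => by simp; omega) h
    simpa [hX, hY] using h

theorem saturated_cnt_comm :
    Saturated {w | ∀ z, cnt z w = cnt z (x * y)} (gen (x * y) (y * x)) := by
  refine saturated_gen fun f p q => ?_
  simp only [Set.mem_ofPred_eq, map_mul, cnt_mul, add_comm (cnt _ (f x))]

theorem eq_of_cnt_x_mul_y {w : M} (h : ∀ z, cnt z w = cnt z (x * y)) : w = x * y ∨ w = y * x := by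
  have hp : w.toList.Perm [0, 1] := List.perm_iff_count.2 h
  obtain ⟨i, j, hij⟩ := List.length_eq_two.1 hp.length_eq
  rw [hij] at hp
  have hi : i = 0 ∨ i = 1 := by simpa using hp.subset (List.mem_cons_self)
  have hj : j = 0 ∨ j = 1 := by simpa using hp.subset (List.mem_cons_of_mem i List.mem_cons_self)
  have hne : i ≠ j := by simpa using hp.nodup_iff.2 (by decide)
  rcases hi with rfl | rfl <;> rcases hj with rfl | rfl
  exacts [absurd rfl hne, Or.inl hij, Or.inr hij, absurd rfl hne]

section Costandard

variable {a : Con M} (h : IsCostandardElem a)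

include h

theorem IsCostandardElem.exists_cnt_ne {K : ℕ}
    (hK : ∀ g w : M, a (g ^ (K + 1) * w) (g ^ K * w * (g * g))) :
    ∃ z u v, a u v ∧ cnt z u = 1 ∧ cnt z v ≠ 1 := by
  by_contra! hcon
  have hd : ∀ g w, gen (x * x * (y * y)) (y * y * (x * x)) (g * g * (w * w)) (w * w * (g * g)) :=
    fun g w => by simpa using gen_map (subst g w) (x * x * (y * y)) (y * y * (x * x))
  have hb : ∀ g, gen (y * x) (x * y * x) g (g * g) :=
    fun g => by simpa using gen_map (subst g 1) (y * x) (x * y * x)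
  have hcomm : ∀ g w, (gen (y * x) (x * y * x) ⊔ gen (x * x * (y * y)) (y * y * (x * x)))
      (g * w) (w * g) := fun g w =>
    Con.trans _ (rel_sup_left (Con.mul _ (hb g) (hb w)))
      (Con.trans _ (rel_sup_right (hd g w)) (rel_sup_left (Con.symm _ (Con.mul _ (hb w) (hb g)))))
  have hrel := h.rel (fullyInvariant_gen (y * x) (x * y * x))
    (fullyInvariant_gen (x * x * (y * y)) (y * y * (x * x))) (rel_sup_left (hK x t)) (by
      rw [pow_succ, mul_assoc (x ^ K), mul_assoc (x ^ K)]
      exact Con.mul _ (Con.refl _ _) (Con.trans _ (hcomm _ _)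
        (Con.mul _ (Con.refl _ _) (rel_sup_left (hb _)))))
  have hsat : Saturated {w | cnt 2 w = 1 ∧ last w = some 2} (a ⊓ gen (y * x) (x * y * x)) := by
    rintro u v ⟨huv, huv'⟩
    exact and_congr ⟨hcon 2 u v huv, hcon 2 v u (a.symm huv)⟩ (saturated_last u v huv')
  have := (hsat.sup saturated_last_of_cnt _ _ hrel).1 (by simp [last_mul]; simp [last, t])
  simp [last_mul] at this
  simp [last, x] at this

theorem IsCostandardElem.idempotent (ha : FullyInvariant a) {K : ℕ}
    (hK : ∀ g w : M, a (g ^ (K + 1) * w) (g ^ K * w * (g * g))) (g : M) : a g (g * g) := by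
  obtain ⟨z, u, v, huv, hu, hv⟩ := h.exists_cnt_ne hK
  have hj : ∀ g, a g (g ^ cnt z v) := fun g => by
    simpa [lift_single, hu] using ha (FreeMonoid.lift fun k => if k = z then g else 1) _ _ huv
  rcases Nat.lt_or_gt_of_ne hv with hv | hv
  · have : ∀ g, a g 1 := by simpa [Nat.lt_one_iff.1 hv] using hj
    exact a.trans (this g) (a.symm (this (g * g)))
  · have hpow : ∀ s, a g (g ^ cnt z v ^ s) := by
      intro s
      induction s with
      | zero => simpa using a.refl g
      | succ s ih =>
        rw [pow_succ, pow_mul]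
        exact a.trans ih (hj _)
    obtain ⟨m, hm⟩ : ∃ m, cnt z v ^ (K + 1) = K + 1 + m :=
      Nat.exists_eq_add_of_le (Nat.lt_pow_self hv).le
    have hN := hpow (K + 1)
    rw [hm] at hN
    have h1 : a (g ^ (K + 1 + m)) (g * g ^ (K + 1 + m)) := by
      rw [← pow_succ', show K + 1 + m + 1 = K + 2 + m by ring, pow_add g (K + 1),
        pow_add g (K + 2)]
      have := hK g 1
      refine a.mul ?_ (a.refl _)
      simpa [pow_add, pow_two] using this
    exact a.trans hN (a.trans h1 (a.mul (a.refl g) (a.symm hN)))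

theorem IsCostandardElem.commutative (ha : FullyInvariant a) (hi : ∀ g, a g (g * g)) (g w : M) :
    a (g * w) (w * g) := by
  suffices hxy : a (x * y) (y * x) by simpa using ha (subst g w) _ _ hxy
  by_contra hcon
  have hrel := h.rel (fullyInvariant_gen (x * y) (y * x))
    (fullyInvariant_gen (x * x * (y * y)) (y * y * (x * x)))
    (Con.trans _ (rel_sup_left (a.mul (hi x) (hi y))) (Con.trans _ (rel_sup_right (gen_rel _ _))
      (rel_sup_left (a.symm (a.mul (hi y) (hi x)))))) (rel_sup_left (gen_rel _ _))
  have key : ∀ w, a (x * y) w → gen (x * y) (y * x) (x * y) w → w = x * y := by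
    intro w hw hw'
    rcases eq_of_cnt_x_mul_y ((saturated_cnt_comm _ _ hw').1 fun _ => rfl) with h | h
    · exact h
    · exact absurd (h ▸ hw) hcon
  have hsat : Saturated {x * y} (a ⊓ gen (x * y) (y * x)) := by
    rintro u v ⟨huv, huv'⟩
    constructor
    · rintro rfl
      exact key _ huv huv'
    · rintro rfl
      exact key _ (a.symm huv) (Con.symm _ huv')
  have := (hsat.sup saturated_singleton_x_mul_y _ _ hrel).1 rfl
  exact x_mul_ne_y_mul _ _ (Eq.symm this)

end Costandard

/-- A commutative idempotent congruence relates all words with equal content. -/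
theorem rel_of_content_eq {a : Con M} (hi : ∀ g, a g (g * g)) (hc : ∀ g w, a (g * w) (w * g))
    {u v : M} (h : ∀ z, cnt z u = 0 ↔ cnt z v = 0) : a u v := by
  have absorb_letter : ∀ z u, cnt z u ≠ 0 → a u (u * FreeMonoid.of z) := by
    intro z u hz
    induction u using FreeMonoid.inductionOn' with
    | one => simp at hz
    | of_mul b u ih =>
      by_cases hb : b = z
      · subst hb
        have h1 := a.mul (hi (FreeMonoid.of b)) (a.refl u)
        rw [mul_assoc] at h1
        refine a.trans h1 ?_
        rw [mul_assoc]
        exact a.mul (a.refl _) (hc _ _)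
      · rw [mul_assoc]
        refine a.mul (a.refl _) (ih ?_)
        simpa [cnt_of, hb] using hz
  have absorb : ∀ v u, (∀ z, cnt z u = 0 → cnt z v = 0) → a u (u * v) := by
    intro v
    induction v using FreeMonoid.inductionOn' with
    | one => intro u _; rw [mul_one]; exact a.refl u
    | of_mul b v ih =>
      intro u hu
      have hb : cnt b u ≠ 0 := fun hb => by
        have := hu b hb
        simp [cnt_of] at this
      have hv : a u (u * v) := ih u fun z hz => by
        have := hu z hz
        rw [cnt_mul] at this
        omega
      rw [← mul_assoc]
      exact a.trans hv (a.mul (absorb_letter b u hb) (a.refl v))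
  exact a.trans (absorb v u fun z => (h z).1)
    (a.trans (hc u v) (a.symm (absorb u v fun z => (h z).2)))

theorem exists_pow_rel_one {c : Con M} (hc : FullyInvariant c) {u v : M} (huv : c u v)
    (h : ¬ ∀ z, cnt z u = 0 ↔ cnt z v = 0) : ∃ k, k ≠ 0 ∧ ∀ w, c (w ^ k) 1 := by
  push Not at h
  obtain ⟨z, hz⟩ := h
  have hr : ∀ w, c (w ^ cnt z u) (w ^ cnt z v) := fun w => by
    simpa only [lift_single] using hc (FreeMonoid.lift fun k => if k = z then w else 1) _ _ huv
  rcases hz with ⟨hu, hv⟩ | ⟨hu, hv⟩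
  · refine ⟨cnt z v, hv, fun w => c.symm ?_⟩
    simpa [hu] using hr w
  · refine ⟨cnt z u, hu, fun w => ?_⟩
    simpa [hv] using hr w

/-- A fully invariant congruence lying above all commutative idempotent identities is standard. -/
theorem isStandardElem_of_content {a : Con M}
    (ha : ∀ u v, (∀ z, cnt z u = 0 ↔ cnt z v = 0) → a u v) : IsStandardElem a := by
  intro b d hb hd
  refine le_antisymm ?_ (sup_le (inf_le_inf_right d le_sup_left) (inf_le_inf_right d le_sup_right))
  by_cases hba : b ≤ a
  · rw [sup_eq_left.2 hba]
    exact le_sup_left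
  by_cases hda : d ≤ a
  · rw [inf_eq_right.2 hda]
    exact inf_le_right.trans le_sup_left
  have pow_rel : ∀ c : Con M, FullyInvariant c → ¬ c ≤ a → ∃ k, k ≠ 0 ∧ ∀ w, c (w ^ k) 1 := by
    intro c hc hca
    rw [Con.le_def] at hca
    push Not at hca
    obtain ⟨u, v, huv, hcon⟩ := hca
    exact exists_pow_rel_one hc huv fun h => hcon (ha u v h)
  obtain ⟨k, hk, hbk⟩ := pow_rel b hb hba
  obtain ⟨m, hm, hdm⟩ := pow_rel d hd hda
  have hbd : ∀ u w, (b ⊓ d) u (u * w ^ (k * m)) := by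
    intro u w
    constructor
    · have := b.mul (b.refl u) (b.symm (hbk (w ^ m)))
      rwa [← pow_mul, mul_one, mul_comm m k] at this
    · have := d.mul (d.refl u) (d.symm (hdm (w ^ k)))
      rwa [← pow_mul, mul_one] at this
  rintro u v ⟨-, huv⟩
  refine Con.trans _ (rel_sup_right (hbd u (u * v))) (Con.trans _ (rel_sup_left ⟨ha _ _ fun z => ?_,
    d.mul huv (d.refl _)⟩) (rel_sup_right (Con.symm _ (hbd v (u * v)))))
  simp [hk, hm]

/-- Every costandard element of the lattice of fully invariant congruences on
the free monoid is a standard element. (Dual rendering of: every standard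
element of 𝕄𝕆ℕ is costandard.) -/
theorem costandard_is_standard (c : Con M) (hc : FullyInvariant c)
    (h : IsCostandardElem c) : IsStandardElem c := by
  by_cases hbot : ∃ u v, c u v ∧ u ≠ v
  · obtain ⟨u, v, huv, hne⟩ := hbot
    obtain ⟨u, v, hu, hv, h0, h1, hne, huv⟩ := exists_balanced hc huv hne
    obtain ⟨K, hK⟩ := h.exists_pow_mul hc hu hv h0 h1 hne huv
    have hi := h.idempotent hc hK
    exact isStandardElem_of_content fun _ _ =>
      rel_of_content_eq hi (h.commutative hc hi)
  · push Not at hbot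
    have hc : c = ⊥ := le_bot_iff.1 fun u v huv => hbot u v huv
    intro b d _ _
    rw [hc, bot_sup_eq, bot_inf_eq, bot_sup_eq]
end

section
/- There exists an injective map F from the lattice L of fully invariant congruences on the free monoid FreeMonoid ℕ to the lattice L' of fully invariant congruences on the free semigroup FreeSemigroup ℕ such that F(a ⊓ b) = F(a) ⊓ F(b) and F(a ⊔ b) = F(a) ⊔ F(b) for all a, b ∈ L; that is, L embeds into L' as a lattice. (Dual rendering of the folklore proposition that the map sending the monoid variety generated by a monoid M to the semigroup variety generated by M is a lattice embedding of 𝕄𝕆ℕ into the lattice 𝕊𝔼𝕄 of semigroup varieties.) -/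
/-- The free semigroup over a countably infinite alphabet. -/
abbrev S : Type := FreeSemigroup ℕ

/-- A congruence on the free semigroup is fully invariant if it is stable
under all endomorphisms of the free semigroup. -/
def FullyInvariantS (c : Con S) : Prop :=
  ∀ f : S →ₙ* S, ∀ u v : S, c u v → c (f u) (f v)

/-- The canonical embedding of the free semigroup into the free monoid. -/
def toMonoid : S →ₙ* M := FreeSemigroup.lift FreeMonoid.of

theorem toMonoid_of (n : ℕ) : toMonoid (FreeSemigroup.of n) = FreeMonoid.of n := by
  simp [toMonoid]

theorem eq_one_of_mul_eq_one {u v : M} (h : u * v = 1) : u = 1 ∧ v = 1 :=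
  List.append_eq_nil_iff.mp h

theorem toMonoid_ne_one (s : S) : toMonoid s ≠ 1 := by
  induction s using FreeSemigroup.recOnMul with
  | ih1 n => rw [toMonoid_of]; exact FreeMonoid.of_ne_one n
  | ih2 n s h _ =>
    rw [map_mul]
    exact fun h' => h (eq_one_of_mul_eq_one h').1

theorem exists_toMonoid_eq {u : M} (hu : u ≠ 1) : ∃ s, toMonoid s = u := by
  induction u using FreeMonoid.inductionOn' with
  | one => exact absurd rfl hu
  | of_mul n u ih =>
    by_cases h : u = 1
    · exact ⟨FreeSemigroup.of n, by rw [toMonoid_of, h, mul_one]⟩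
    · obtain ⟨s, rfl⟩ := ih h
      exact ⟨FreeSemigroup.of n * s, by rw [map_mul, toMonoid_of]⟩

/-- The restriction of a congruence on the free monoid to the free semigroup. -/
def restrict (c : Con M) : Con S := c.comap toMonoid (map_mul toMonoid)

theorem restrict_apply {c : Con M} {s t : S} :
    restrict c s t ↔ c (toMonoid s) (toMonoid t) := Iff.rfl

theorem fullyInvariantS_restrict {c : Con M} (hc : FullyInvariant c) :
    FullyInvariantS (restrict c) := by
  intro f s t h
  let g : M →* M := FreeMonoid.lift fun n => toMonoid (f (FreeSemigroup.of n))
  have hg : (g : M →ₙ* M).comp toMonoid = toMonoid.comp f := by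
    apply FreeSemigroup.hom_ext
    funext n
    simp [g, toMonoid_of]
  have key : ∀ s, toMonoid (f s) = g (toMonoid s) := fun s => (DFunLike.congr_fun hg s).symm
  rw [restrict_apply, key, key]
  exact hc g _ _ h

theorem le_of_restrict_le {a b : Con M} (ha : FullyInvariant a)
    (hb : FullyInvariant b) (h : restrict a ≤ restrict b) : a ≤ b := by
  intro u v huv
  let shift : M →* M := FreeMonoid.map Nat.succ
  let drop : M →* M := FreeMonoid.lift fun n => Nat.casesOn n 1 FreeMonoid.of
  have hds : drop.comp shift = MonoidHom.id M := by
    apply FreeMonoid.hom_eq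
    intro n
    simp [drop, shift]
  have hdrop : ∀ w, drop (FreeMonoid.of 0 * shift w) = w := fun w => by
    rw [map_mul]
    simpa [drop] using DFunLike.congr_fun hds w
  have hne : ∀ w, FreeMonoid.of 0 * shift w ≠ 1 := fun w hw =>
    FreeMonoid.of_ne_one 0 (eq_one_of_mul_eq_one hw).1
  obtain ⟨s, hs⟩ := exists_toMonoid_eq (hne u)
  obtain ⟨t, ht⟩ := exists_toMonoid_eq (hne v)
  have hst : restrict a s t := by
    rw [restrict_apply, hs, ht]
    exact a.mul (a.refl _) (ha shift _ _ huv)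
  have hb' := hb drop _ _ (restrict_apply.mp (h hst))
  rwa [hs, ht, hdrop, hdrop] at hb'

theorem restrict_mono {a b : Con M} (h : a ≤ b) : restrict a ≤ restrict b :=
  fun {_ _} hst => h hst

/-- If `1` is alone in its `a`- and `b`-classes, then the words in a chain joining two nonempty
words are all nonempty. -/
theorem restrict_sup_le_of_one_isolated {a b : Con M} (ha : ∀ u, a u 1 → u = 1)
    (hb : ∀ u, b u 1 → u = 1) : restrict (a ⊔ b) ≤ restrict a ⊔ restrict b := by
  have hJ {p q : S} (h : toMonoid p = toMonoid q) : (restrict a ⊔ restrict b) p q :=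
    (le_sup_left : restrict a ≤ _) (restrict_apply.mpr (h ▸ a.refl _))
  let K : Con M :=
    { r := fun u v => (u = 1 ↔ v = 1) ∧ ∀ x z p q, toMonoid p = x * u * z →
        toMonoid q = x * v * z → (restrict a ⊔ restrict b) p q
      iseqv :=
        { refl := fun u => ⟨Iff.rfl, fun x z p q hp hq => hJ (hp.trans hq.symm)⟩
          symm := fun h => ⟨h.1.symm, fun x z p q hp hq => Con.symm _ (h.2 x z q p hq hp)⟩
          trans := by
            rintro u v w ⟨h₁, h₂⟩ ⟨h₃, h₄⟩
            refine ⟨h₁.trans h₃, fun x z p q hp hq => ?_⟩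
            by_cases hv : v = 1
            · rw [h₁.mpr hv] at hp
              rw [h₃.mp hv] at hq
              exact hJ (hp.trans hq.symm)
            · have : x * v * z ≠ 1 := fun h =>
                hv (eq_one_of_mul_eq_one (eq_one_of_mul_eq_one h).1).2
              obtain ⟨r, hr⟩ := exists_toMonoid_eq this
              exact Con.trans _ (h₂ x z p r hp hr) (h₄ x z r q hr hq) }
      mul' := by
        rintro u v u' v' ⟨h₁, h₂⟩ ⟨h₃, h₄⟩
        have hone : ∀ s t : M, s * t = 1 ↔ s = 1 ∧ t = 1 := fun s t =>
          ⟨eq_one_of_mul_eq_one, fun h => by rw [h.1, h.2, mul_one]⟩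
        refine ⟨by rw [hone, hone, h₁, h₃], fun x z p q hp hq => ?_⟩
        by_cases hm : x * u * v' * z = 1
        · obtain ⟨⟨⟨hx, hu⟩, hv'⟩, hz⟩ : ((x = 1 ∧ u = 1) ∧ v' = 1) ∧ z = 1 := by
            rwa [hone, hone, hone] at hm
          have hp' : toMonoid p = 1 := by
            rw [hp, hx, hu, h₃.mpr hv', hz]; rfl
          exact absurd hp' (toMonoid_ne_one p)
        · obtain ⟨r, hr⟩ := exists_toMonoid_eq hm
          refine Con.trans _ (h₄ (x * u) z p r ?_ hr) (h₂ x (v' * z) r q ?_ ?_)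
          · simpa only [mul_assoc] using hp
          · simpa only [mul_assoc] using hr
          · simpa only [mul_assoc] using hq }
  have hK : ∀ c : Con M, (∀ u, c u 1 → u = 1) → restrict c ≤ restrict a ⊔ restrict b →
      c ≤ K := by
    intro c hc hle u v huv
    refine ⟨⟨fun h => hc v (h ▸ c.symm huv), fun h => hc u (h ▸ huv)⟩, fun x z p q hp hq => ?_⟩
    apply hle
    rw [restrict_apply, hp, hq]
    exact c.mul (c.mul (c.refl x) huv) (c.refl z)
  intro s t hst
  have : K (toMonoid s) (toMonoid t) :=
    (sup_le (hK a ha le_sup_left) (hK b hb le_sup_right)) hst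
  exact this.2 1 1 s t (by simp) (by simp)

/-- If some nonempty word `e` is `a`-related to `1`, then a chain joining two nonempty words can
be multiplied on the right by `e`. -/
theorem restrict_sup_le_of_rel_one {a b : Con M} {e : M} (he : e ≠ 1) (hae : a e 1) :
    restrict (a ⊔ b) ≤ restrict a ⊔ restrict b := by
  have hne (u : M) : ∃ s, toMonoid s = u * e :=
    exists_toMonoid_eq fun h => he (eq_one_of_mul_eq_one h).2
  have hJ {p q : S} (h : a (toMonoid p) (toMonoid q)) : (restrict a ⊔ restrict b) p q :=
    (le_sup_left : restrict a ≤ _) (restrict_apply.mpr h)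
  let K : Con M :=
    { r := fun u v => ∀ x z p q, toMonoid p = x * u * z * e →
        toMonoid q = x * v * z * e → (restrict a ⊔ restrict b) p q
      iseqv :=
        { refl := fun u x z p q hp hq => hJ (by rw [hp, hq]; exact a.refl _)
          symm := fun h x z p q hp hq => Con.symm _ (h x z q p hq hp)
          trans := by
            intro u v w h₁ h₂ x z p q hp hq
            obtain ⟨r, hr⟩ := hne (x * v * z)
            exact Con.trans _ (h₁ x z p r hp hr) (h₂ x z r q hr hq) }
      mul' := by
        intro u v u' v' h₁ h₂ x z p q hp hq
        obtain ⟨r, hr⟩ := hne (x * u * v' * z)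
        refine Con.trans _ (h₂ (x * u) z p r ?_ hr) (h₁ x (v' * z) r q ?_ ?_)
        · simpa only [mul_assoc] using hp
        · simpa only [mul_assoc] using hr
        · simpa only [mul_assoc] using hq }
  have hK : ∀ c : Con M, restrict c ≤ restrict a ⊔ restrict b → c ≤ K := by
    intro c hle u v huv x z p q hp hq
    apply hle
    rw [restrict_apply, hp, hq]
    exact c.mul (c.mul (c.mul (c.refl x) huv) (c.refl z)) (c.refl e)
  intro s t hst
  have hmul (u : M) : a u (u * e) := by
    simpa using a.mul (a.refl u) (a.symm hae)
  obtain ⟨p, hp⟩ := hne (toMonoid s)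
  obtain ⟨q, hq⟩ := hne (toMonoid t)
  have hpq : (restrict a ⊔ restrict b) p q :=
    (sup_le (hK a le_sup_left) (hK b le_sup_right)) hst 1 1 p q (by simpa) (by simpa)
  refine Con.trans _ (hJ ?_) (Con.trans _ hpq (Con.symm _ (hJ ?_)))
  · rw [hp]; exact hmul _
  · rw [hq]; exact hmul _

theorem restrict_sup (a b : Con M) : restrict (a ⊔ b) = restrict a ⊔ restrict b := by
  refine le_antisymm ?_ (sup_le (restrict_mono le_sup_left) (restrict_mono le_sup_right))
  by_cases ha : ∀ u, a u 1 → u = 1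
  · by_cases hb : ∀ u, b u 1 → u = 1
    · exact restrict_sup_le_of_one_isolated ha hb
    · push Not at hb
      obtain ⟨e, hbe, he⟩ := hb
      rw [sup_comm a, sup_comm (restrict a)]
      exact restrict_sup_le_of_rel_one he hbe
  · push Not at ha
    obtain ⟨e, hae, he⟩ := ha
    exact restrict_sup_le_of_rel_one he hae

/-- The lattice of fully invariant congruences on the free monoid embeds into
the lattice of fully invariant congruences on the free semigroup: there is a
map `F` sending fully invariant congruences to fully invariant congruences,
injective on fully invariant congruences, preserving binary meets and joins of
fully invariant congruences. (Dual rendering of: 𝕄𝕆ℕ embeds into 𝕊𝔼𝕄 as a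
lattice.) -/
theorem monoid_lattice_embeds_into_semigroup_lattice :
    ∃ F : Con M → Con S,
      (∀ c : Con M, FullyInvariant c → FullyInvariantS (F c)) ∧
      (∀ a b : Con M, FullyInvariant a → FullyInvariant b →
        F a = F b → a = b) ∧
      (∀ a b : Con M, FullyInvariant a → FullyInvariant b →
        F (a ⊓ b) = F a ⊓ F b) ∧
      (∀ a b : Con M, FullyInvariant a → FullyInvariant b →
        F (a ⊔ b) = F a ⊔ F b) := by
  refine ⟨restrict, fun c hc => fullyInvariantS_restrict hc, fun a b ha hb h => ?_, fun a b _ _ => rfl,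
    fun a b _ _ => restrict_sup a b⟩
  exact le_antisymm (le_of_restrict_le ha hb h.le) (le_of_restrict_le hb ha h.ge)
end
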